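/- arXiv:1812.01264 — 7 statements merged into one kernel-verified Lean document; each statement's English description precedes it below -/
import Mathlib

section
/- Let Ω = Λ ∪ Υ (Λ, Υ disjoint) be a set of finitary operation symbols and let L be an Ω-lattice each of whose operations f^L is isotone in each coordinate. Then there exist an index set I, an ultrafilter U on I, and an injective bounded-lattice homomorphism from a canonical extension L^σ of L into a MacNeille completion of the ultrapower L^U that commutes with all the Ω-operations, where L^σ carries the lower canonical extensions (f^L)^▽ for f ∈ Λ and the upper canonical extensions (f^L)^△ for f ∈ Υ, and the MacNeille completion of L^U carries the lower MacNeille extensions of the ultrapower operations for f ∈ Λ and their upper MacNeille extensions for f ∈ Υ. -/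
open FirstOrder FirstOrder.Language FirstOrder.Language.Structure

namespace PaperCore

/-! ### Typed polarities and stable set lattices -/

section Pol
variable {X Y : Type*}

def rho (R : X → Y → Prop) (A : Set X) : Set Y := {y | ∀ x ∈ A, R x y}

def lam (R : X → Y → Prop) (B : Set Y) : Set X := {x | ∀ y ∈ B, R x y}

def IsStable (R : X → Y → Prop) (A : Set X) : Prop := lam R (rho R A) ⊆ A

def IsStableY (R : X → Y → Prop) (B : Set Y) : Prop := rho R (lam R B) ⊆ B

lemma rho_anti {R : X → Y → Prop} {A B : Set X} (h : A ⊆ B) : rho R B ⊆ rho R A :=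
  fun y hy x hx => hy x (h hx)

lemma lam_anti {R : X → Y → Prop} {B B' : Set Y} (h : B ⊆ B') : lam R B' ⊆ lam R B :=
  fun x hx y hy => hx y (h hy)

lemma lamrho_mono {R : X → Y → Prop} {A B : Set X} (h : A ⊆ B) :
    lam R (rho R A) ⊆ lam R (rho R B) := lam_anti (rho_anti h)

def Stable (R : X → Y → Prop) : Type _ := {A : Set X // IsStable R A}

namespace Stable

variable {R : X → Y → Prop}

instance : PartialOrder (Stable R) :=
  inferInstanceAs (PartialOrder {A : Set X // IsStable R A})

lemma le_def {A B : Stable R} : A ≤ B ↔ A.1 ⊆ B.1 := Iff.rfl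

instance : InfSet (Stable R) :=
  ⟨fun S => ⟨⋂ A ∈ S, A.1, fun x hx => Set.mem_iInter₂.2 fun A hA =>
    A.2 (lamrho_mono (Set.biInter_subset_of_mem hA) hx)⟩⟩

instance : CompleteLattice (Stable R) :=
  completeLatticeOfInf _ (fun S =>
    ⟨fun A hA => Set.biInter_subset_of_mem hA,
     fun B hB => Set.subset_iInter₂ fun A hA => hB hA⟩)

end Stable
end Pol

/-! ### Ultraproducts of indexed families (as plain quotients) -/

section UProd
variable {I : Type*}

def uSetoid (U : Ultrafilter I) (β : I → Type*) : Setoid (∀ i, β i) where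
  r f g := {i | f i = g i} ∈ U
  iseqv := by
    refine ⟨fun f => ?_, fun {f g} h => ?_, fun {f g h} h1 h2 => ?_⟩
    · exact Filter.univ_mem' (fun i => rfl)
    · exact Filter.mem_of_superset h fun i hi => (hi : f i = g i).symm
    · exact Filter.mem_of_superset (Filter.inter_mem h1 h2) fun i hi =>
        (hi.1 : f i = g i).trans hi.2

def UProd (U : Ultrafilter I) (β : I → Type*) : Type _ := Quotient (uSetoid U β)

def uMk (U : Ultrafilter I) {β : I → Type*} (f : ∀ i, β i) : UProd U β :=
  Quotient.mk (uSetoid U β) f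

lemma uMk_surjective (U : Ultrafilter I) (β : I → Type*) :
    Function.Surjective (uMk U (β := β)) := Quotient.mk''_surjective

/-- `θ(α^U)`: the subset of the ultraproduct determined by a family of subsets. -/
def thetaSet (U : Ultrafilter I) {β : I → Type*} (α : ∀ i, Set (β i)) : Set (UProd U β) :=
  fun m => Quotient.liftOn m (fun f => {i | f i ∈ α i} ∈ U) (by
    intro f g hfg
    refine propext ⟨fun hf => ?_, fun hg => ?_⟩
    · exact Filter.mem_of_superset (Filter.inter_mem hf hfg) fun i hi =>
        show g i ∈ α i from hi.2 ▸ hi.1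
    · exact Filter.mem_of_superset (Filter.inter_mem hg hfg) fun i hi =>
        show f i ∈ α i from hi.2.symm ▸ hi.1)

lemma mem_thetaSet (U : Ultrafilter I) {β : I → Type*} (α : ∀ i, Set (β i)) (f : ∀ i, β i) :
    uMk U f ∈ thetaSet U α ↔ {i | f i ∈ α i} ∈ U := Iff.rfl

end UProd

/-! ### Completions: closed/open elements, density, compactness -/

section Completion
variable {C : Type*} [CompleteLattice C]

def ClosedElt (img : Set C) (c : C) : Prop := ∃ S ⊆ img, c = sInf S

def OpenElt (img : Set C) (c : C) : Prop := ∃ S ⊆ img, c = sSup S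

/-- The completion with image `img` is dense. -/
def DenseCompletion (img : Set C) : Prop :=
  ∀ x : C, (∃ G, (∀ c ∈ G, ClosedElt img c) ∧ x = sSup G) ∧
    (∃ G, (∀ o ∈ G, OpenElt img o) ∧ x = sInf G)

/-- The completion with image `img` is compact. -/
def CompactCompletion (img : Set C) : Prop :=
  ∀ S T : Set C, (∀ c ∈ S, ClosedElt img c) → (∀ o ∈ T, OpenElt img o) →
    sInf S ≤ sSup T →
      ∃ S' T' : Finset C, ↑S' ⊆ S ∧ ↑T' ⊆ T ∧ sInf (S' : Set C) ≤ sSup (T' : Set C)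

def JoinDense (img : Set C) : Prop := ∀ x : C, ∃ G ⊆ img, x = sSup G

def MeetDense (img : Set C) : Prop := ∀ x : C, ∃ G ⊆ img, x = sInf G

/-! Canonical and MacNeille extensions of `n`-ary isotone maps. -/

variable {L : Type*}

def lowerCanExt {n : ℕ} (η : L → C) (g : (Fin n → L) → L) (x : Fin n → C) : C :=
  sSup {z | ∃ p : Fin n → C, (∀ j, ClosedElt (Set.range η) (p j)) ∧ (∀ j, p j ≤ x j) ∧
    z = sInf {w | ∃ a : Fin n → L, (∀ j, p j ≤ η (a j)) ∧ w = η (g a)}}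

def upperCanExt {n : ℕ} (η : L → C) (g : (Fin n → L) → L) (x : Fin n → C) : C :=
  sInf {z | ∃ q : Fin n → C, (∀ j, OpenElt (Set.range η) (q j)) ∧ (∀ j, x j ≤ q j) ∧
    z = sSup {w | ∃ a : Fin n → L, (∀ j, η (a j) ≤ q j) ∧ w = η (g a)}}

def lowerMacExt {n : ℕ} (η : L → C) (g : (Fin n → L) → L) (x : Fin n → C) : C :=
  sSup {w | ∃ a : Fin n → L, (∀ j, η (a j) ≤ x j) ∧ w = η (g a)}

def upperMacExt {n : ℕ} (η : L → C) (g : (Fin n → L) → L) (x : Fin n → C) : C :=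
  sInf {w | ∃ a : Fin n → L, (∀ j, x j ≤ η (a j)) ∧ w = η (g a)}

/-- `F` preserves arbitrary joins (including the empty join) in each coordinate. -/
def CompleteNormalOp {n : ℕ} (F : (Fin n → C) → C) : Prop :=
  ∀ (as : Fin n → C) (j : Fin n) (G : Set C),
    F (Function.update as j (sSup G)) = ⨆ B ∈ G, F (Function.update as j B)

/-- `F` preserves arbitrary meets (including the empty meet) in each coordinate. -/
def CompleteNormalDualOp {n : ℕ} (F : (Fin n → C) → C) : Prop :=
  ∀ (as : Fin n → C) (j : Fin n) (G : Set C),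
    F (Function.update as j (sInf G)) = ⨅ B ∈ G, F (Function.update as j B)

end Completion

/-! ### First-order polarity-based structures and definable operations -/

section FO

/-- The language with `n` fresh unary relation symbols `S₀, …, S_{n-1}`. -/
def unaryLang (n : ℕ) : FirstOrder.Language where
  Functions := fun _ => Empty
  Relations := fun k => match k with
    | 1 => Fin n
    | _ => Empty

/-- The structure interpreting each `Sₘ` as `A m`. -/
def unaryStructure {M : Type*} {n : ℕ} (A : Fin n → Set M) : (unaryLang n).Structure M where
  funMap := fun {k} f _ => f.elim
  RelMap := fun {k} => match k with
    | 0 => fun r _ => r.elim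
    | 1 => fun r v => v 0 ∈ A r
    | (_ + 2) => fun r _ => r.elim

/-- The expansion `⟨P, A₀, …, A_{n-1}⟩` of a structure by `n` set parameters. -/
def withParams {L : FirstOrder.Language} {M : Type*} [L.Structure M] {n : ℕ}
    (A : Fin n → Set M) : (L.sum (unaryLang n)).Structure M :=
  letI := unaryStructure A
  inferInstance

variable {L : FirstOrder.Language} {M : Type*} [L.Structure M]

def pX (Xb : L.Relations 1) (M : Type*) [L.Structure M] : Set M := {m | RelMap Xb ![m]}

def pR (Rb : L.Relations 2) : M → M → Prop := fun a b => RelMap Rb ![a, b]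

/-- The operation on subsets of `X` defined by a formula `φ(v)` of `𝓛*_n`:
`f^P_φ(A₀,…,A_{n-1}) = {x ∈ X : ⟨P, A⟩ ⊨ φ[x]}`. -/
def defOp (Xb : L.Relations 1) {n : ℕ}
    (φ : (L.sum (unaryLang n)).Formula (Fin 1)) (A : Fin n → Set M) : Set M :=
  {x | x ∈ pX Xb M ∧ @Formula.Realize _ M (withParams A) _ φ (fun _ => x)}

/-- Set-based polarity data inside a one-sorted universe. -/
def rhoS (Yset : Set M) (R : M → M → Prop) (A : Set M) : Set M :=
  {y | y ∈ Yset ∧ ∀ x ∈ A, R x y}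

def lamS (Xset : Set M) (R : M → M → Prop) (B : Set M) : Set M :=
  {x | x ∈ Xset ∧ ∀ y ∈ B, R x y}

def IsStableS (Xset Yset : Set M) (R : M → M → Prop) (A : Set M) : Prop :=
  A ⊆ Xset ∧ lamS Xset R (rhoS Yset R A) ⊆ A

def StableS (Xset Yset : Set M) (R : M → M → Prop) : Type _ :=
  {A : Set M // IsStableS Xset Yset R A}

namespace StableS

variable {Xset Yset : Set M} {R : M → M → Prop}

lemma lamS_subset (B : Set M) : lamS Xset R B ⊆ Xset := fun _ hx => hx.1

lemma rhoS_anti {A B : Set M} (h : A ⊆ B) : rhoS Yset R B ⊆ rhoS Yset R A :=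
  fun y hy => ⟨hy.1, fun x hx => hy.2 x (h hx)⟩

lemma lamS_anti {B B' : Set M} (h : B ⊆ B') : lamS Xset R B' ⊆ lamS Xset R B :=
  fun x hx => ⟨hx.1, fun y hy => hx.2 y (h hy)⟩

lemma lamrhoS_mono {A B : Set M} (h : A ⊆ B) :
    lamS Xset R (rhoS Yset R A) ⊆ lamS Xset R (rhoS Yset R B) :=
  lamS_anti (rhoS_anti (Yset := Yset) h)

instance : PartialOrder (StableS Xset Yset R) :=
  inferInstanceAs (PartialOrder {A : Set M // IsStableS Xset Yset R A})

lemma le_def {A B : StableS Xset Yset R} : A ≤ B ↔ A.1 ⊆ B.1 := Iff.rfl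

instance : InfSet (StableS Xset Yset R) :=
  ⟨fun S => ⟨Xset ∩ ⋂ A ∈ S, A.1,
    ⟨Set.inter_subset_left, fun x hx =>
      ⟨(lamS_subset _) hx, Set.mem_iInter₂.2 fun A hA =>
        A.2.2 (lamrhoS_mono (Set.inter_subset_right.trans (Set.biInter_subset_of_mem hA)) hx)⟩⟩⟩⟩

instance : CompleteLattice (StableS Xset Yset R) :=
  completeLatticeOfInf _ (fun S =>
    ⟨fun A hA => (Set.inter_subset_right.trans (Set.biInter_subset_of_mem hA) :
        Xset ∩ ⋂ A ∈ S, A.1 ⊆ A.1),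
     fun B hB => Set.subset_inter B.2.1 (Set.subset_iInter₂ fun A hA => hB hA)⟩)

end StableS

end FO

end PaperCore

namespace PaperCore

/-! ### Good ultrafilters -/

section Good

universe u

open Filter Cardinal

/-- The form of `|Λ|⁺`-goodness (together with `Λ`-regularity) used to saturate ultrapowers. -/
def IsGoodFor {I : Type*} (U : Ultrafilter I) (Λ : Type*) : Prop :=
  ∀ f : Finset Λ → Set I, (∀ s, f s ∈ U) →
    ∃ g : I → Finset Λ, ∀ a, {i | a ∈ g i ∧ i ∈ f (g i)} ∈ U

/-- The functions `G k`, for `k ∉ W`, are independent modulo the filter `D`. -/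
def IndepMod {I K V : Type*} (G : K → I → V) (D : Filter I) (W : Set K) : Prop :=
  ∀ (s : Finset K) (v : K → V), Disjoint (s : Set K) W → ∀ B ∈ D, ∃ i ∈ B, ∀ k ∈ s, G k i = v k

/-- The filter `E` either refutes some value of `f`, or contains a refinement of `f` as required
by `IsGoodFor`. -/
def Settles {I Λ : Type*} (f : Finset Λ → Set I) (E : Filter I) : Prop :=
  (∃ s, (f s)ᶜ ∈ E) ∨ ∃ g : I → Finset Λ, ∀ a, {i | a ∈ g i ∧ i ∈ f (g i)} ∈ E

lemma Settles.mono {I Λ : Type*} {f : Finset Λ → Set I} {E E' : Filter I} (h : Settles f E)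
    (hE : E' ≤ E) : Settles f E' :=
  h.imp (fun ⟨s, hs⟩ => ⟨s, hE hs⟩) fun ⟨g, hg⟩ => ⟨g, fun a => hE (hg a)⟩

lemma IndepMod.exists_settles {I Λ K : Type*} {G : K → I → Finset Λ} {D : Filter I} {W : Set K}
    (h : IndepMod G D W) (hW : W ≠ Set.univ) (f : Finset Λ → Set I) :
    ∃ (E : Filter I) (φ : Finset K), E ≤ D ∧ IndepMod G E (W ∪ φ) ∧ Settles f E := by
  classical
  by_cases hf : ∀ s, IndepMod G (D ⊓ 𝓟 (f s)) W
  · obtain ⟨k, hk⟩ := (Set.ne_univ_iff_exists_notMem W).1 hW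
    refine ⟨D ⊓ comap (G k) atTop ⊓ 𝓟 {i | i ∈ f (G k i)}, {k}, inf_le_left.trans inf_le_left,
      ?_, .inr ⟨G k, fun a => ?_⟩⟩
    · intro s v hs B hB
      rw [mem_inf_principal, mem_inf_iff_superset] at hB
      obtain ⟨B₀, hB₀, C, hC, hBC⟩ := hB
      obtain ⟨A, hA, hAC⟩ := mem_comap.1 hC
      obtain ⟨t, ht⟩ := mem_atTop_sets.1 hA
      rw [Set.disjoint_union_right] at hs
      have hks : k ∉ s := by simpa using hs.2
      obtain ⟨i, hi, hiv⟩ := hf t (insert k s) (Function.update v k t)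
        (by simpa [hk] using hs.1) (B₀ ∩ f t) (inter_mem_inf hB₀ (mem_principal_self _))
      have hit : G k i = t := by simpa using hiv k (by simp)
      refine ⟨i, hBC ⟨hi.1, hAC ?_⟩ ?_, fun k' hk' => ?_⟩
      · simpa [hit] using ht t le_rfl
      · simpa [hit] using hi.2
      · have hne : k' ≠ k := fun e => hks (e ▸ hk')
        simpa [hne] using hiv k' (by simp [hk'])
    · rw [mem_inf_principal]
      have : {i | a ∈ G k i} ∈ comap (G k) atTop :=
        mem_comap.2 ⟨{t | a ∈ t}, mem_atTop_sets.2 ⟨{a}, fun t ht => ht (by simp)⟩, fun _ h => h⟩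
      filter_upwards [mem_inf_of_right this] with i hi hi' using ⟨hi, hi'⟩
  · simp only [IndepMod, not_forall, not_exists, not_and] at hf
    obtain ⟨s, t, v, ht, B, hB, hBt⟩ := hf
    rw [mem_inf_principal] at hB
    refine ⟨D ⊓ 𝓟 {i | ∀ k ∈ t, G k i = v k}, t, inf_le_left, ?_, .inl ⟨s, ?_⟩⟩
    · intro s' v' hs' B' hB'
      rw [mem_inf_principal] at hB'
      rw [Set.disjoint_union_right, Finset.disjoint_coe] at hs'
      obtain ⟨i, hi, hiv⟩ := h (t ∪ s') (fun k => if k ∈ t then v k else v' k)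
        (by simpa using ⟨ht, hs'.1⟩) _ hB'
      refine ⟨i, hi fun k hk => ?_, fun k hk => ?_⟩
      · simpa [hk] using hiv k (by simp [hk])
      · have hkt : k ∉ t := Finset.disjoint_left.1 hs'.2 hk
        simpa [hkt] using hiv k (by simp [hk])
    · rw [mem_inf_principal]
      filter_upwards [hB] with i hi hi' his
      obtain ⟨k, hk, hne⟩ := hBt i (hi his)
      exact hne (hi' k hk)

/-- If an independent family exceeds every initial segment of the family of requirements in
cardinality, then all requirements can be met by a single ultrafilter. -/
lemma IndepMod.exists_isGoodFor {I Λ K T : Type u} {G : K → I → Finset Λ}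
    (hG : IndepMod G ⊤ ∅) [LinearOrder T] [WellFoundedLT T] [Nonempty T]
    (hK : ℵ₀ < #K) (hT : ∀ t : T, #(Set.Iio t) < #K)
    (τ : T → Finset Λ → Set I) (hτ : Function.Surjective τ) :
    ∃ U : Ultrafilter I, IsGoodFor U Λ := by
  classical
  have hstep : ∀ (f : Finset Λ → Set I) (D : Filter I) (W : Set K),
      ∃ X : Filter I × Finset K, IndepMod G D W → W ≠ Set.univ →
        X.1 ≤ D ∧ IndepMod G X.1 (W ∪ X.2) ∧ Settles f X.1 := by
    intro f D W
    by_cases h : IndepMod G D W ∧ W ≠ Set.univ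
    · obtain ⟨E, φ, hE⟩ := h.1.exists_settles h.2 f
      exact ⟨(E, φ), fun _ _ => hE⟩
    · exact ⟨(⊤, ∅), fun h₁ h₂ => (h ⟨h₁, h₂⟩).elim⟩
  choose step hstep using hstep
  let X : T → Filter I × Finset K := IsWellFounded.fix (motive := fun _ => Filter I × Finset K) (· < ·)
    fun t X => step (τ t) (⨅ s : Set.Iio t, (X s.1 s.2).1)
      (⋃ s : Set.Iio t, ((X s.1 s.2).2 : Set K))
  have hX : ∀ t, X t = step (τ t) (⨅ s : Set.Iio t, (X s.1).1) (⋃ s : Set.Iio t, ((X s.1).2 : Set K)) :=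
    fun t => IsWellFounded.fix_eq _ _ t
  have hW : ∀ t, (⋃ s : Set.Iio t, ((X s.1).2 : Set K)) ≠ Set.univ := by
    intro t e
    have h₁ : #(⋃ s : Set.Iio t, ((X s.1).2 : Set K)) ≤ #(Set.Iio t) * ℵ₀ := by
      refine (mk_iUnion_le_sum_mk).trans ((sum_le_sum _ (fun _ => ℵ₀) fun s => ?_).trans ?_)
      · exact mk_le_aleph0
      · simp
    rw [e, mk_univ] at h₁
    exact h₁.not_gt (mul_lt_of_lt hK.le (hT t) hK)
  have key : ∀ t, IndepMod G (⨅ s : Set.Iio t, (X s.1).1) (⋃ s : Set.Iio t, ((X s.1).2 : Set K)) := by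
    intro t
    induction t using WellFoundedLT.induction with
    | ind t ih =>
      have hs : ∀ s < t, (X s).1 ≤ (⨅ r : Set.Iio s, (X r.1).1) ∧
          IndepMod G (X s).1 ((⋃ r : Set.Iio s, ((X r.1).2 : Set K)) ∪ (X s).2) := by
        intro s hst
        have := hstep (τ s) _ _ (ih s hst) (hW s)
        rw [← hX] at this
        exact ⟨this.1, this.2.1⟩
      intro F v hF B hB
      rcases isEmpty_or_nonempty (Set.Iio t) with he | hne
      · rw [iInf_of_empty] at hB
        exact hG F v (by simp) B hB
      · have hdir : Directed (· ≥ ·) fun s : Set.Iio t => (X s).1 := by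
          refine Antitone.directed_ge fun a b hab => ?_
          rcases hab.eq_or_lt with rfl | hlt
          · exact le_rfl
          · exact (hs b b.2).1.trans (iInf_le (fun r : Set.Iio (b : T) => (X r).1) ⟨a, hlt⟩)
        obtain ⟨s, hsB⟩ := (mem_iInf_of_directed hdir B).1 hB
        refine (hs s s.2).2 F v (hF.mono_right ?_) B hsB
        refine Set.union_subset (Set.iUnion_subset fun r => ?_) ?_
        · exact Set.subset_iUnion (fun r : Set.Iio t => ((X r.1).2 : Set K)) ⟨r, r.2.trans s.2⟩
        · exact Set.subset_iUnion (fun r : Set.Iio t => ((X r.1).2 : Set K)) s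
  have hX' : ∀ t, (X t).1 ≤ (⨅ r : Set.Iio t, (X r.1).1) ∧
      IndepMod G (X t).1 ((⋃ r : Set.Iio t, ((X r.1).2 : Set K)) ∪ (X t).2) ∧
      Settles (τ t) (X t).1 := by
    intro t
    have := hstep (τ t) _ _ (key t) (hW t)
    rwa [← hX] at this
  have hdir : Directed (· ≥ ·) fun t => (X t).1 := by
    refine Antitone.directed_ge fun a b hab => ?_
    rcases hab.eq_or_lt with rfl | hlt
    · exact le_rfl
    · exact (hX' b).1.trans (iInf_le (fun r : Set.Iio b => (X r).1) ⟨a, hlt⟩)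
  have hne : (⨅ t, (X t).1).NeBot := by
    refine iInf_neBot_of_directed' hdir fun t => ⟨fun e => ?_⟩
    obtain ⟨i, hi, -⟩ := (hX' t).2.1 ∅ (fun _ => ∅) (by simp) ∅ (by rw [e]; exact mem_bot)
    exact hi
  refine ⟨Ultrafilter.of (⨅ t, (X t).1), fun f hf => ?_⟩
  obtain ⟨t, rfl⟩ := hτ f
  rcases (hX' t).2.2.mono ((Ultrafilter.of_le _).trans (iInf_le (fun t => (X t).1) t)) with
    ⟨s, hs⟩ | h
  · exact (Ultrafilter.compl_mem_iff_notMem.1 hs (hf s)).elim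
  · exact h

/-- On a set of the size of an infinite `Λ` there are `2 ^ |Λ|` independent functions. -/
lemma exists_indepMod (Λ V : Type*) [Nonempty Λ] [Nonempty V] :
    ∃ G : Set Λ → Finset Λ × Finset (Finset Λ × V) → V, IndepMod G ⊤ ∅ := by
  classical
  refine ⟨fun A i => if h : ∃ w, (i.1.filter (· ∈ A), w) ∈ i.2 then h.choose else
    Classical.arbitrary V, fun s v _ B hB => ?_⟩
  have hsep : ∀ A A' : Set Λ, ∃ d : Λ, (d ∈ A ↔ d ∈ A') → A = A' := by
    intro A A'
    by_contra! h
    exact (h (Classical.arbitrary Λ)).2 (Set.ext fun d => (h d).1)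
  choose d hd using hsep
  let S : Finset Λ := (s ×ˢ s).image fun p => d p.1 p.2
  have hS : ∀ A ∈ s, ∀ A' ∈ s, S.filter (· ∈ A) = S.filter (· ∈ A') → A = A' := by
    intro A hA A' hA' e
    have hdS : d A A' ∈ S := Finset.mem_image.2 ⟨(A, A'), by simp [hA, hA'], rfl⟩
    refine hd A A' ?_
    simpa [hdS] using Finset.ext_iff.1 e (d A A')
  refine ⟨(S, s.image fun A => (S.filter (· ∈ A), v A)), by simp [mem_top.1 hB], fun A hA => ?_⟩
  have h : ∃ w, (S.filter (· ∈ A), w) ∈ s.image fun A => (S.filter (· ∈ A), v A) :=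
    ⟨v A, Finset.mem_image_of_mem _ hA⟩
  obtain ⟨A', hA', e⟩ := Finset.mem_image.1 h.choose_spec
  rw [Prod.mk.injEq] at e
  change (if h : _ then _ else _) = _
  rw [dif_pos h, ← e.2, hS A' hA' A hA e.1]

lemma exists_isGoodFor_of_infinite (Λ : Type u) [Infinite Λ] :
    ∃ (I : Type u) (U : Ultrafilter I), IsGoodFor U Λ := by
  obtain ⟨G, hG⟩ := exists_indepMod Λ (Finset Λ)
  have hI : #(Finset Λ × Finset (Finset Λ × Finset Λ)) = #Λ := by
    simp [mk_finset_of_infinite]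
  have hK : #(Set Λ) = 2 ^ #Λ := mk_set
  have hreq : #(Finset Λ → Set (Finset Λ × Finset (Finset Λ × Finset Λ))) = #(Set Λ) := by
    rw [← power_def, mk_set, hI, mk_finset_of_infinite, ← power_mul,
      mul_eq_self (aleph0_le_mk Λ), hK]
  let T := (#(Set Λ)).ord.ToType
  have e : T ≃ (Finset Λ → Set (Finset Λ × Finset (Finset Λ × Finset Λ))) :=
    (Cardinal.eq.1 (by rw [hreq, mk_ord_toType])).some
  have : Nonempty T := e.nonempty
  exact ⟨_, hG.exists_isGoodFor (T := T)
    (by rw [hK]; exact (aleph0_le_mk Λ).trans_lt (cantor _))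
    (fun t => by simpa [T] using mk_Iio_lt t) e e.surjective⟩

lemma exists_isGoodFor (Λ : Type u) [Nonempty Λ] :
    ∃ (I : Type u) (U : Ultrafilter I), IsGoodFor U Λ := by
  classical
  obtain ⟨I, U, hU⟩ := exists_isGoodFor_of_infinite (Λ × ℕ)
  refine ⟨I, U, fun f hf => ?_⟩
  obtain ⟨g, hg⟩ := hU (fun s => f (s.image Prod.fst)) fun s => hf _
  refine ⟨fun i => (g i).image Prod.fst, fun a => mem_of_superset (hg (a, 0)) fun i hi => ?_⟩
  exact ⟨Finset.mem_image_of_mem Prod.fst hi.1, hi.2⟩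

/-- Ultrapowers modulo good ultrafilters are saturated. -/
lemma IsGoodFor.saturated {I Λ β : Type*} [Nonempty β] {U : Ultrafilter I} (hU : IsGoodFor U Λ)
    (P : Λ → I → β → Prop) (hP : ∀ s : Finset Λ, ∀ᶠ i in (U : Filter I), ∃ b, ∀ a ∈ s, P a i b) :
    ∃ m : I → β, ∀ a, ∀ᶠ i in (U : Filter I), P a i (m i) := by
  classical
  obtain ⟨g, hg⟩ := hU (fun s => {i | ∃ b, ∀ a ∈ s, P a i b}) hP
  refine ⟨fun i => if h : ∃ b, ∀ a ∈ g i, P a i b then h.choose else Classical.arbitrary β,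
    fun a => mem_of_superset (hg a) fun i hi => ?_⟩
  have h : ∃ b, ∀ a ∈ g i, P a i b := hi.2
  simpa [dif_pos h] using h.choose_spec a hi.1

end Good

end PaperCore

namespace PaperCore

/-! ### Comparing a canonical extension with an ultrapower -/

section Hull

open Filter

variable {L C I : Type*} [Lattice L] [BoundedOrder L] [CompleteLattice C]

lemma monotone_of_update {n : ℕ} {L M : Type*} [Preorder L] [Preorder M] {g : (Fin n → L) → M}
    (hg : ∀ (a : Fin n → L) (j : Fin n) (x y : L), x ≤ y →
      g (Function.update a j x) ≤ g (Function.update a j y)) : Monotone g := by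
  classical
  intro a b hab
  have key : ∀ s : Finset (Fin n), g a ≤ g (s.piecewise b a) := by
    intro s
    induction s using Finset.induction_on with
    | empty => simp
    | insert j s hj ih =>
      refine ih.trans ?_
      rw [Finset.piecewise_insert]
      have hself : Function.update (s.piecewise b a) j (a j) = s.piecewise b a := by
        rw [Function.update_eq_self_iff, Finset.piecewise_eq_of_notMem _ _ _ hj]
      simpa only [hself] using hg (s.piecewise b a) j _ _ (hab j)
  simpa only [Finset.piecewise_univ] using key Finset.univ

lemma DenseCompletion.dual {img : Set C} (h : DenseCompletion img) :
    DenseCompletion (C := Cᵒᵈ) img := fun x => ⟨(h x).2, (h x).1⟩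

lemma CompactCompletion.dual {img : Set C} (h : CompactCompletion img) :
    CompactCompletion (C := Cᵒᵈ) img := fun S T hS hT hST =>
  let ⟨S', T', hS', hT', hle⟩ := h T S hT hS hST
  ⟨T', S', hT', hS', hle⟩

/-- The least closed element above the element of the ultrapower represented by `m`. -/
def upHull (U : Ultrafilter I) (η : BoundedLatticeHom L C) (m : I → L) : C :=
  sInf {c | ∃ a, (∀ᶠ i in (U : Filter I), m i ≤ a) ∧ c = η a}

/-- The greatest open element below the element of the ultrapower represented by `n`. -/
def lowHull (U : Ultrafilter I) (η : BoundedLatticeHom L C) (n : I → L) : C :=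
  sSup {c | ∃ a, (∀ᶠ i in (U : Filter I), a ≤ n i) ∧ c = η a}

variable {U : Ultrafilter I} {η : BoundedLatticeHom L C}

lemma upHull_le {m : I → L} {a : L} (h : ∀ᶠ i in (U : Filter I), m i ≤ a) :
    upHull U η m ≤ η a := sInf_le ⟨a, h, rfl⟩

lemma le_lowHull {n : I → L} {a : L} (h : ∀ᶠ i in (U : Filter I), a ≤ n i) :
    η a ≤ lowHull U η n := le_sSup ⟨a, h, rfl⟩

lemma ClosedElt.eq_sInf {p : C} (hp : ClosedElt (Set.range η) p) :
    p = sInf {c | ∃ a, p ≤ η a ∧ c = η a} := by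
  obtain ⟨S, hS, rfl⟩ := hp
  refine le_antisymm (le_sInf ?_) (le_sInf fun c hc => ?_)
  · rintro _ ⟨a, ha, rfl⟩
    exact ha
  · obtain ⟨a, rfl⟩ := hS hc
    exact sInf_le ⟨a, sInf_le hc, rfl⟩

lemma DenseCompletion.le_of_forall_closed (h : DenseCompletion (Set.range η)) {x y : C}
    (hxy : ∀ p, ClosedElt (Set.range η) p → p ≤ x → p ≤ y) : x ≤ y := by
  obtain ⟨G, hG, rfl⟩ := (h x).1
  exact sSup_le fun p hp => hxy p (hG p hp) (le_sSup hp)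

lemma closedElt_upHull (m : I → L) : ClosedElt (Set.range η) (upHull U η m) :=
  ⟨_, by rintro _ ⟨a, -, rfl⟩; exact ⟨a, rfl⟩, rfl⟩

lemma exists_mem_le_sInf {F : Set L} (htop : ⊤ ∈ F) (hinf : ∀ a ∈ F, ∀ b ∈ F, a ⊓ b ∈ F)
    (S : Finset C) (hS : ∀ c ∈ S, ∃ a ∈ F, c = η a) : ∃ a ∈ F, η a ≤ sInf (S : Set C) := by
  classical
  induction S using Finset.induction_on with
  | empty => exact ⟨⊤, htop, by simp⟩
  | insert c S _ ih =>
    obtain ⟨a, ha, haS⟩ := ih fun c hc => hS c (Finset.mem_insert_of_mem hc)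
    obtain ⟨b, hb, rfl⟩ := hS c (Finset.mem_insert_self _ _)
    refine ⟨b ⊓ a, hinf b hb a ha, ?_⟩
    rw [InfHomClass.map_inf, Finset.coe_insert, sInf_insert]
    exact inf_le_inf_left _ haS

lemma exists_mem_sSup_le {T : Set L} (hbot : ⊥ ∈ T) (hsup : ∀ a ∈ T, ∀ b ∈ T, a ⊔ b ∈ T)
    (S : Finset C) (hS : ∀ c ∈ S, ∃ a ∈ T, c = η a) : ∃ a ∈ T, sSup (S : Set C) ≤ η a :=
  exists_mem_le_sInf (C := Cᵒᵈ) (η := BoundedLatticeHom.dual η) (F := T) hbot hsup S hS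

/-- An element of the ultrapower whose upper hull lies below the lower hull of another one is
below the latter. -/
lemma eventually_le_of_upHull_le (hinj : Function.Injective η)
    (hc : CompactCompletion (Set.range η)) {m n : I → L} (h : upHull U η m ≤ lowHull U η n) :
    ∀ᶠ i in (U : Filter I), m i ≤ n i := by
  obtain ⟨S, T, hS, hT, hST⟩ := hc _ _
    (by rintro _ ⟨a, -, rfl⟩; exact ⟨{η a}, by simp, by simp⟩)
    (by rintro _ ⟨a, -, rfl⟩; exact ⟨{η a}, by simp, by simp⟩) h
  obtain ⟨a, ha, haS⟩ := exists_mem_le_sInf (η := η)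
    (F := {a | ∀ᶠ i in (U : Filter I), m i ≤ a}) (by simp)
    (fun a ha b hb => by filter_upwards [ha, hb] with i h₁ h₂ using le_inf h₁ h₂) S hS
  obtain ⟨b, hb, hbT⟩ := exists_mem_sSup_le (η := η)
    (T := {a | ∀ᶠ i in (U : Filter I), a ≤ n i}) (by simp)
    (fun a ha b hb => by filter_upwards [ha, hb] with i h₁ h₂ using sup_le h₁ h₂) T hT
  have hab : a ≤ b := by
    have := haS.trans (hST.trans hbT)
    rwa [← inf_eq_left, ← InfHomClass.map_inf, hinj.eq_iff, inf_eq_left] at this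
  filter_upwards [ha, hb] with i h₁ h₂ using h₁.trans (hab.trans h₂)

lemma upHull_le_iff (hinj : Function.Injective η) (hc : CompactCompletion (Set.range η))
    {m : I → L} {a : L} : upHull U η m ≤ η a ↔ ∀ᶠ i in (U : Filter I), m i ≤ a :=
  ⟨fun h => eventually_le_of_upHull_le hinj hc (n := fun _ => a)
    (h.trans (le_lowHull (Eventually.of_forall fun _ => le_rfl))), upHull_le⟩

/-- Every closed element is an upper hull. -/
lemma IsGoodFor.exists_upHull_eq (hU : IsGoodFor U L) {p : C}
    (hp : ClosedElt (Set.range η) p) : ∃ m, upHull U η m = p := by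
  classical
  have hfin : ∀ s : Finset L, ∃ b, ∀ a ∈ s, (p ≤ η a ↔ b ≤ a) := by
    refine fun s => ⟨(s.filter fun a => p ≤ η a).inf id, fun a ha => ⟨fun h => ?_, fun h => ?_⟩⟩
    · exact Finset.inf_le (f := id) (by simp [ha, h])
    · refine le_trans ?_ (OrderHomClass.mono η h)
      rw [map_finset_inf]
      exact Finset.le_inf fun b hb => (Finset.mem_filter.1 hb).2
  obtain ⟨m, hm⟩ := hU.saturated (fun a _ b => (p ≤ η a ↔ b ≤ a)) fun s =>
    Eventually.of_forall fun _ => hfin s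
  refine ⟨m, ?_⟩
  rw [hp.eq_sInf]
  refine congrArg sInf (Set.ext fun c => exists_congr fun a => and_congr_left' ⟨fun h => ?_,
    fun h => ?_⟩)
  · obtain ⟨i, h₁, h₂⟩ := (h.and (hm a)).exists
    exact h₂.2 h₁
  · filter_upwards [hm a] with i hi using hi.1 h

/-- If `g` maps all tuples below `p` in the ultrapower to elements below `n`, then this is
witnessed by some tuple of the base lattice. -/
lemma IsGoodFor.exists_apply_le (hU : IsGoodFor U L) {k : ℕ} (g : (Fin k → L) → L)
    (p : Fin k → C) (n : I → L)
    (h : ∀ m : Fin k → I → L, (∀ j a, p j ≤ η a → ∀ᶠ i in (U : Filter I), m j i ≤ a) →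
      ∀ᶠ i in (U : Filter I), g (fun j => m j i) ≤ n i) :
    ∃ a : Fin k → L, (∀ j, p j ≤ η (a j)) ∧ ∀ᶠ i in (U : Filter I), g a ≤ n i := by
  classical
  by_contra! hcon
  obtain ⟨m, hm⟩ := hU.saturated
    (fun a i (b : Fin k → L) => (∀ j, p j ≤ η a → b j ≤ a) ∧ ¬ g b ≤ n i) fun s => by
      let b : Fin k → L := fun j => (s.filter fun a => p j ≤ η a).inf id
      have hb : ∀ j, p j ≤ η (b j) := fun j => by
        rw [map_finset_inf]
        exact Finset.le_inf fun b hb => (Finset.mem_filter.1 hb).2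
      filter_upwards [hcon b hb] with i hi
      exact ⟨b, fun a ha => ⟨fun j hj => Finset.inf_le (f := id) (by simp [ha, hj]), hi⟩⟩
  have hle := h (fun j i => m i j) fun j a ha => (hm a).mono fun i hi => hi.1 j ha
  obtain ⟨i, h₁, h₂⟩ := (hle.and (hm ⊥)).exists
  exact h₂.2 h₁

lemma lowerCanExt_le_lowHull (hU : IsGoodFor U L) {k : ℕ} (g : (Fin k → L) → L)
    (x : Fin k → C) (n : I → L)
    (h : ∀ m : Fin k → I → L, (∀ j, upHull U η (m j) ≤ x j) →
      ∀ᶠ i in (U : Filter I), g (fun j => m j i) ≤ n i) :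
    lowerCanExt η g x ≤ lowHull U η n := by
  refine sSup_le ?_
  rintro _ ⟨p, hp, hpx, rfl⟩
  obtain ⟨a, ha, hga⟩ := hU.exists_apply_le g p n fun m hm => h m fun j => by
    refine le_trans ?_ (hpx j)
    conv_rhs => rw [(hp j).eq_sInf]
    refine le_sInf ?_
    rintro _ ⟨a, ha, rfl⟩
    exact upHull_le (hm j a ha)
  exact sInf_le_of_le ⟨a, ha, rfl⟩ (le_lowHull hga)

lemma upHull_apply_le_lowerCanExt (hinj : Function.Injective η)
    (hc : CompactCompletion (Set.range η)) {k : ℕ} {g : (Fin k → L) → L} (hg : Monotone g)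
    {x : Fin k → C} {m : Fin k → I → L} (hm : ∀ j, upHull U η (m j) ≤ x j) :
    upHull U η (fun i => g fun j => m j i) ≤ lowerCanExt η g x := by
  refine le_sSup_of_le ⟨_, fun j => closedElt_upHull (m j), hm, rfl⟩ (le_sInf ?_)
  rintro _ ⟨a, ha, rfl⟩
  refine upHull_le ?_
  filter_upwards [eventually_all.2 fun j => (upHull_le_iff hinj hc).1 (ha j)] with i hi
  exact hg hi

lemma le_lowHull_of_forall (hU : IsGoodFor U L) (hd : DenseCompletion (Set.range η)) {x : C}
    {n : I → L} (h : ∀ m, upHull U η m ≤ x → ∀ᶠ i in (U : Filter I), m i ≤ n i) :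
    x ≤ lowHull U η n := by
  refine hd.le_of_forall_closed fun p hp hpx => ?_
  obtain ⟨a, ha, han⟩ := hU.exists_apply_le (fun b : Fin 1 → L => b 0) (fun _ => p) n
    fun m hm => h (m 0) <| by
      refine le_trans ?_ hpx
      conv_rhs => rw [hp.eq_sInf]
      refine le_sInf ?_
      rintro _ ⟨a, ha, rfl⟩
      exact upHull_le (hm 0 a ha)
  exact (ha 0).trans (le_lowHull han)

lemma upHull_le_of_forall (hU : IsGoodFor U L) (hd : DenseCompletion (Set.range η)) {x : C}
    {m : I → L} (h : ∀ n, x ≤ lowHull U η n → ∀ᶠ i in (U : Filter I), m i ≤ n i) :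
    upHull U η m ≤ x :=
  le_lowHull_of_forall (L := Lᵒᵈ) (C := Cᵒᵈ) (η := BoundedLatticeHom.dual η) hU hd.dual h

end Hull

section Embedding

open Filter

variable {L C I M : Type*} [Lattice L] [BoundedOrder L] [CompleteLattice C] [CompleteLattice M]

/-- The extension to the canonical extension of the embedding `ν` of the ultrapower. -/
def hullMap (U : Ultrafilter I) (η : BoundedLatticeHom L C) (ν : (I → L) → M) (x : C) : M :=
  sSup {w | ∃ m, upHull U η m ≤ x ∧ w = ν m}

variable {U : Ultrafilter I} {η : BoundedLatticeHom L C} {ν : (I → L) → M}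

lemma hullMap_le_iff (hU : IsGoodFor U L) (hinj : Function.Injective η)
    (hd : DenseCompletion (Set.range η)) (hc : CompactCompletion (Set.range η))
    (hν : ∀ m n, ν m ≤ ν n ↔ ∀ᶠ i in (U : Filter I), m i ≤ n i) {x : C} {n : I → L} :
    hullMap U η ν x ≤ ν n ↔ x ≤ lowHull U η n := by
  refine ⟨fun h => le_lowHull_of_forall hU hd fun m hm => (hν _ _).1 ?_, fun h => sSup_le ?_⟩
  · exact (le_sSup ⟨m, hm, rfl⟩ : ν m ≤ hullMap U η ν x).trans h
  · rintro _ ⟨m, hm, rfl⟩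
    exact (hν _ _).2 (eventually_le_of_upHull_le hinj hc (hm.trans h))

lemma le_hullMap_iff (hU : IsGoodFor U L) (hinj : Function.Injective η)
    (hd : DenseCompletion (Set.range η)) (hc : CompactCompletion (Set.range η))
    (hν : ∀ m n, ν m ≤ ν n ↔ ∀ᶠ i in (U : Filter I), m i ≤ n i) {x : C} {m : I → L} :
    ν m ≤ hullMap U η ν x ↔ upHull U η m ≤ x := by
  refine ⟨fun h => upHull_le_of_forall hU hd fun n hn => (hν _ _).1 (h.trans ?_),
    fun h => le_sSup ⟨m, h, rfl⟩⟩
  exact (hullMap_le_iff hU hinj hd hc hν).2 hn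

lemma JoinDense.le_of_forall {ι : Type*} {ν : ι → M} (hj : JoinDense (Set.range ν)) {x y : M}
    (h : ∀ m, ν m ≤ x → ν m ≤ y) : x ≤ y := by
  obtain ⟨G, hG, rfl⟩ := hj x
  refine sSup_le fun c hc => ?_
  obtain ⟨m, rfl⟩ := hG hc
  exact h m (le_sSup hc)

lemma MeetDense.le_of_forall {ι : Type*} {ν : ι → M} (hm : MeetDense (Set.range ν)) {x y : M}
    (h : ∀ n, y ≤ ν n → x ≤ ν n) : x ≤ y :=
  JoinDense.le_of_forall (M := Mᵒᵈ) (ν := ν) hm h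

lemma map_inf_of_le_iff {ι : Type*} {ν : ι → M} (hj : JoinDense (Set.range ν)) {h : C → M} {u : ι → C}
    (hlo : ∀ m x, ν m ≤ h x ↔ u m ≤ x) (x y : C) : h (x ⊓ y) = h x ⊓ h y :=
  le_antisymm (hj.le_of_forall fun m hm => by simpa [hlo] using hm)
    (hj.le_of_forall fun m hm => by simpa [hlo] using hm)

lemma map_top_of_le_iff {ι : Type*} {ν : ι → M} (hj : JoinDense (Set.range ν)) {h : C → M} {u : ι → C}
    (hlo : ∀ m x, ν m ≤ h x ↔ u m ≤ x) : h ⊤ = ⊤ :=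
  top_le_iff.1 (hj.le_of_forall fun m _ => (hlo m ⊤).2 le_top)

lemma map_lowerCanExt (hU : IsGoodFor U L) (hinj : Function.Injective η)
    (hc : CompactCompletion (Set.range η)) (hm : MeetDense (Set.range ν))
    (hν : ∀ m n, ν m ≤ ν n ↔ ∀ᶠ i in (U : Filter I), m i ≤ n i) {h : C → M}
    (hlo : ∀ m x, ν m ≤ h x ↔ upHull U η m ≤ x) (hup : ∀ n x, h x ≤ ν n ↔ x ≤ lowHull U η n)
    {k : ℕ} {g : (Fin k → L) → L} (hg : Monotone g) (x : Fin k → C) :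
    h (lowerCanExt η g x) =
      sSup {w | ∃ m : Fin k → I → L, (∀ j, ν (m j) ≤ h (x j)) ∧ w = ν fun i => g fun j => m j i} := by
  refine le_antisymm (hm.le_of_forall fun n hn => ?_) (sSup_le ?_)
  · refine (hup _ _).2 (lowerCanExt_le_lowHull hU g x n fun m hmx => (hν _ _).1 ?_)
    exact (sSup_le_iff.1 hn) _ ⟨m, fun j => (hlo _ _).2 (hmx j), rfl⟩
  · rintro _ ⟨m, hmx, rfl⟩
    exact (hlo _ _).2 (upHull_apply_le_lowerCanExt hinj hc hg fun j => (hlo _ _).1 (hmx j))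

lemma map_upperCanExt (hU : IsGoodFor U L) (hinj : Function.Injective η)
    (hc : CompactCompletion (Set.range η)) (hj : JoinDense (Set.range ν))
    (hν : ∀ m n, ν m ≤ ν n ↔ ∀ᶠ i in (U : Filter I), m i ≤ n i) {h : C → M}
    (hlo : ∀ m x, ν m ≤ h x ↔ upHull U η m ≤ x) (hup : ∀ n x, h x ≤ ν n ↔ x ≤ lowHull U η n)
    {k : ℕ} {g : (Fin k → L) → L} (hg : Monotone g) (x : Fin k → C) :
    h (upperCanExt η g x) =
      sInf {w | ∃ m : Fin k → I → L, (∀ j, h (x j) ≤ ν (m j)) ∧ w = ν fun i => g fun j => m j i} :=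
  map_lowerCanExt (L := Lᵒᵈ) (C := Cᵒᵈ) (M := Mᵒᵈ) (ν := ν) (h := h)
    (η := BoundedLatticeHom.dual η) hU hinj hc.dual hj (fun m n => hν n m) hup hlo
    (g := g) (fun _ _ hab => hg hab) x

end Embedding

end PaperCore

open PaperCore in
/-- Theorem 2.1 of the paper: for any monotone `Ω`-lattice `L` there exist an
index set `I`, an ultrafilter `U` on `I`, and an injective bounded-lattice homomorphism from
a canonical extension `L^σ` of `L` into a MacNeille completion of the ultrapower `L^U`,
commuting with all the `Ω`-operations (lower extensions for `Λ`, upper extensions for `Υ`). -/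
theorem statement6 {Lc : Type} [Lattice Lc] [BoundedOrder Lc]
    {Ω : Type*} (ar : Ω → ℕ) (Lam Ups : Set Ω) (hdisj : Disjoint Lam Ups)
    (hcover : Lam ∪ Ups = Set.univ)
    (ops : ∀ f : Ω, (Fin (ar f) → Lc) → Lc)
    (hmono : ∀ (f : Ω) (a : Fin (ar f) → Lc) (j : Fin (ar f)) (x y : Lc), x ≤ y →
      ops f (Function.update a j x) ≤ ops f (Function.update a j y)) :
    ∃ (I : Type) (U : Ultrafilter I),
      ∀ (Cσ : Type) [CompleteLattice Cσ] (η : BoundedLatticeHom Lc Cσ),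
        Function.Injective η → DenseCompletion (Set.range ⇑η) →
        CompactCompletion (Set.range ⇑η) →
      ∀ (Cm : Type) [CompleteLattice Cm] (μ : UProd U (fun _ : I => Lc) → Cm),
        Function.Injective μ →
        (∀ a b : I → Lc, μ (uMk U (fun i => a i ⊓ b i)) = μ (uMk U a) ⊓ μ (uMk U b)) →
        (∀ a b : I → Lc, μ (uMk U (fun i => a i ⊔ b i)) = μ (uMk U a) ⊔ μ (uMk U b)) →
        μ (uMk U (fun _ => (⊤ : Lc))) = ⊤ → μ (uMk U (fun _ => (⊥ : Lc))) = ⊥ →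
        JoinDense (Set.range μ) → MeetDense (Set.range μ) →
      ∀ opU : ∀ f : Ω, (Fin (ar f) → UProd U (fun _ : I => Lc)) → UProd U (fun _ : I => Lc),
        (∀ (f : Ω) (a : Fin (ar f) → (I → Lc)),
          opU f (fun j => uMk U (a j)) = uMk U (fun i => ops f (fun j => a j i))) →
      ∃ h : Cσ → Cm,
        Function.Injective h ∧
        (∀ x y : Cσ, h (x ⊓ y) = h x ⊓ h y) ∧
        (∀ x y : Cσ, h (x ⊔ y) = h x ⊔ h y) ∧
        h ⊤ = ⊤ ∧ h ⊥ = ⊥ ∧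
        (∀ f ∈ Lam, ∀ x : Fin (ar f) → Cσ,
          h (lowerCanExt (⇑η) (ops f) x) = lowerMacExt μ (opU f) (fun j => h (x j))) ∧
        (∀ f ∈ Ups, ∀ x : Fin (ar f) → Cσ,
          h (upperCanExt (⇑η) (ops f) x) = upperMacExt μ (opU f) (fun j => h (x j))) := by
  classical
  obtain ⟨I, U, hU⟩ := exists_isGoodFor Lc
  refine ⟨I, U, ?_⟩
  intro Cσ _ η hinj hd hc Cm _ μ hμ hinf _ _ _ hj hm opU hop
  have hmon : ∀ f, Monotone (ops f) := fun f => monotone_of_update (hmono f)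
  let ν : (I → Lc) → Cm := fun a => μ (uMk U a)
  have hrange : Set.range ν = Set.range μ := (uMk_surjective U fun _ => Lc).range_comp μ
  rw [← hrange] at hj hm
  have hν : ∀ a b, ν a ≤ ν b ↔ ∀ᶠ i in (U : Filter I), a i ≤ b i := by
    intro a b
    rw [← inf_eq_left, ← hinf, hμ.eq_iff]
    refine Quotient.eq.trans ?_
    refine Filter.eventually_congr (Filter.Eventually.of_forall fun i => ?_)
    exact inf_eq_left
  have hlo : ∀ a x, ν a ≤ hullMap U η ν x ↔ upHull U η a ≤ x :=
    fun _ _ => le_hullMap_iff hU hinj hd hc hν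
  have hup : ∀ a x, hullMap U η ν x ≤ ν a ↔ x ≤ lowHull U η a :=
    fun _ _ => hullMap_le_iff hU hinj hd hc hν
  have hle : ∀ x y, hullMap U η ν x ≤ hullMap U η ν y → x ≤ y := by
    intro x y hxy
    refine hd.le_of_forall_closed fun p hp hpx => ?_
    obtain ⟨a, rfl⟩ := hU.exists_upHull_eq hp
    exact (hlo _ _).1 (((hlo _ _).2 hpx).trans hxy)
  have hrep : ∀ (f : Ω) (P : (Fin (ar f) → UProd U fun _ : I => Lc) → Prop),
      {w | ∃ a : Fin (ar f) → I → Lc, P (fun j => uMk U (a j)) ∧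
        w = ν fun i => ops f fun j => a j i} = {w | ∃ a, P a ∧ w = μ (opU f a)} := by
    intro f P
    ext w
    refine ⟨fun ⟨a, ha, hw⟩ => ⟨_, ha, by rw [hop]; exact hw⟩, fun ⟨a, ha, hw⟩ => ?_⟩
    choose b hb using fun j => uMk_surjective U (fun _ => Lc) (a j)
    obtain rfl : (fun j => uMk U (b j)) = a := funext hb
    exact ⟨b, ha, by rw [hw, hop]⟩
  refine ⟨hullMap U η ν, fun x y hxy => (hle x y hxy.le).antisymm (hle y x hxy.ge),
    map_inf_of_le_iff hj hlo, map_inf_of_le_iff (C := Cσᵒᵈ) (M := Cmᵒᵈ) (ν := ν) hm hup,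
    map_top_of_le_iff hj hlo, map_top_of_le_iff (C := Cσᵒᵈ) (M := Cmᵒᵈ) (ν := ν) hm hup,
    fun f _ x => ?_, fun f _ x => ?_⟩
  · exact (map_lowerCanExt hU hinj hc hm hν hlo hup (hmon f) x).trans
      (congrArg sSup (hrep f fun a => ∀ j, μ (a j) ≤ hullMap U η ν (x j)))
  · exact (map_upperCanExt hU hinj hc hj hν hlo hup (hmon f) x).trans
      (congrArg sInf (hrep f fun a => ∀ j, hullMap U η ν (x j) ≤ μ (a j)))
end

section
/- Let P be a polarity and U an ultrafilter on a set I. The map θ : (P⁺)^U → (P^U)⁺ sending β^U to {g^U ∈ ∏_U X : {i : g(i) ∈ β(i)} ∈ U} is a MacNeille completion of the ultrapower (P⁺)^U: it is an injective bounded-lattice homomorphism into the complete lattice (P^U)⁺ whose image is both join-dense and meet-dense in (P^U)⁺, i.e. every element of (P^U)⁺ is a join of elements of θ[(P⁺)^U] and also a meet of elements of θ[(P⁺)^U]. -/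
open FirstOrder FirstOrder.Language FirstOrder.Language.Structure

namespace PaperCore
section URel
variable {I : Type*}

/-- The lifted polarity relation `R^U` on the ultraproduct. -/
def uRel (U : Ultrafilter I) {X Y : I → Type*} (R : ∀ i, X i → Y i → Prop) :
    UProd U X → UProd U Y → Prop :=
  Quotient.lift₂ (fun f g => {i | R i (f i) (g i)} ∈ U) (by
    intro f g f' g' hf hg
    have hf' : {i | f i = f' i} ∈ U := hf
    have hg' : {i | g i = g' i} ∈ U := hg
    refine propext ⟨fun h => ?_, fun h => ?_⟩
    · refine Filter.mem_of_superset
        (Filter.inter_mem (Filter.inter_mem h hf') hg') ?_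
      rintro i ⟨⟨h1, h2⟩, h3⟩
      show R i (f' i) (g' i)
      rw [← show f i = f' i from h2, ← show g i = g' i from h3]
      exact h1
    · refine Filter.mem_of_superset
        (Filter.inter_mem (Filter.inter_mem h hf') hg') ?_
      rintro i ⟨⟨h1, h2⟩, h3⟩
      show R i (f i) (g i)
      rw [show f i = f' i from h2, show g i = g' i from h3]
      exact h1)

lemma uRel_mk (U : Ultrafilter I) {X Y : I → Type*} (R : ∀ i, X i → Y i → Prop)
    (f : ∀ i, X i) (g : ∀ i, Y i) :
    uRel U R (uMk U f) (uMk U g) ↔ {i | R i (f i) (g i)} ∈ U := Iff.rfl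

end URel
end PaperCore

namespace PaperCore

section StableLattice
variable {X Y : Type*} {R : X → Y → Prop}

lemma isStable_lam (R : X → Y → Prop) (B : Set Y) : IsStable R (lam R B) :=
  fun _ hx y hy => hx y fun _ hx' => hx' y hy

lemma IsStable.lam_rho_eq {A : Set X} (hA : IsStable R A) : lam R (rho R A) = A :=
  hA.antisymm fun x hx _ hy => hy x hx

namespace Stable

/-- The stable set `λB`. -/
def ofLam (R : X → Y → Prop) (B : Set Y) : Stable R := ⟨lam R B, isStable_lam R B⟩

lemma val_inf (A B : Stable R) : (A ⊓ B).1 = A.1 ∩ B.1 := by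
  have hAB : IsStable R (A.1 ∩ B.1) := fun x hx =>
    ⟨A.2 (lamrho_mono Set.inter_subset_left hx), B.2 (lamrho_mono Set.inter_subset_right hx)⟩
  refine Set.Subset.antisymm (Set.subset_inter (inf_le_left (a := A)) (inf_le_right (a := A))) ?_
  let C : Stable R := ⟨A.1 ∩ B.1, hAB⟩
  have hA : C ≤ A := le_def.2 Set.inter_subset_left
  have hB : C ≤ B := le_def.2 Set.inter_subset_right
  exact le_def.1 (le_inf hA hB)

lemma val_sup (A B : Stable R) : (A ⊔ B).1 = lam R (rho R A.1 ∩ rho R B.1) := by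
  refine Set.Subset.antisymm ?_ ?_
  · exact sup_le (c := ofLam R (rho R A.1 ∩ rho R B.1))
      (le_def.2 fun x hx _ hy => hy.1 x hx) (le_def.2 fun x hx _ hy => hy.2 x hx)
  · rw [← (A ⊔ B).2.lam_rho_eq]
    exact lam_anti (Set.subset_inter (rho_anti (le_sup_left (a := A) (b := B)))
      (rho_anti (le_sup_right (a := A) (b := B))))

lemma val_top : (⊤ : Stable R).1 = Set.univ :=
  Set.eq_univ_of_forall fun _ => le_def.1 (le_top (a := ofLam R ∅)) fun _ hy => hy.elim

lemma val_bot : (⊥ : Stable R).1 = lam R Set.univ := by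
  refine Set.Subset.antisymm (bot_le (a := ofLam R Set.univ)) ?_
  rw [← (⊥ : Stable R).2.lam_rho_eq]
  exact lam_anti (Set.subset_univ _)

lemma eq_sSup_principal (A : Stable R) :
    A = sSup ((fun x => ofLam R (rho R {x})) '' A.1) := by
  refine le_antisymm (fun x hx => ?_) (sSup_le ?_)
  · exact le_sSup (Set.mem_image_of_mem (fun x => ofLam R (rho R {x})) hx)
      (fun y hy => hy x rfl)
  · rintro _ ⟨x, hx, rfl⟩ z hz
    exact A.2 (lamrho_mono (Set.singleton_subset_iff.2 hx) hz)

lemma eq_sInf_principal (A : Stable R) :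
    A = sInf ((fun y => ofLam R {y}) '' rho R A.1) := by
  refine le_antisymm (le_sInf ?_) (fun x hx => A.2 fun y hy => ?_)
  · rintro _ ⟨y, hy, rfl⟩ x hx _ rfl
    exact hy x hx
  · exact sInf_le (Set.mem_image_of_mem (fun y => ofLam R {y}) hy) hx y rfl

end Stable
end StableLattice

section Theta
variable {I : Type*} (U : Ultrafilter I) {X Y : I → Type*}

/-- A property with a witness at almost every index has a globally defined choice of witnesses
that works at almost every index. -/
lemma exists_choice_of_eventually_exists {Y : Type*} {p : I → Y → Prop}
    (h : {i | ∃ y, p i y} ∈ U) : ∃ g : I → Y, {i | p i (g i)} ∈ U := by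
  obtain ⟨i₀, y₀, -⟩ := U.nonempty_of_mem h
  have : Nonempty Y := ⟨y₀⟩
  choose! g hg using fun i (hi : ∃ y, p i y) => hi
  exact ⟨g, Filter.mem_of_superset h hg⟩

lemma thetaSet_inter (A B : ∀ i, Set (X i)) :
    thetaSet U (fun i => A i ∩ B i) = thetaSet U A ∩ thetaSet U B := by
  ext m
  obtain ⟨f, rfl⟩ := uMk_surjective U X m
  exact Filter.inter_mem_iff

lemma thetaSet_univ : thetaSet U (fun i => (Set.univ : Set (X i))) = Set.univ := by
  ext m
  obtain ⟨f, rfl⟩ := uMk_surjective U X m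
  exact ⟨fun _ => trivial, fun _ => Filter.univ_mem' fun _ => trivial⟩

lemma thetaSet_singleton (f : ∀ i, X i) : thetaSet U (fun i => {f i}) = {uMk U f} := by
  ext m
  obtain ⟨g, rfl⟩ := uMk_surjective U X m
  exact ⟨fun h => Quotient.sound (s := uSetoid U X) h,
    fun h => Quotient.exact (s := uSetoid U X) h⟩

lemma thetaSet_congr {A B : ∀ i, Set (X i)} (h : {i | A i = B i} ∈ U) :
    thetaSet U A = thetaSet U B := by
  ext m
  obtain ⟨f, rfl⟩ := uMk_surjective U X m
  exact Filter.congr_sets (Filter.mem_of_superset h fun i (hi : A i = B i) => by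
    simp only [Set.mem_ofPred_eq, hi])

lemma eventually_subset_of_thetaSet_subset {X : Type*} {A B : I → Set X}
    (h : thetaSet U A ⊆ thetaSet U B) : {i | A i ⊆ B i} ∈ U := by
  by_contra hn
  have hn' : {i | ∃ x, x ∈ A i ∧ x ∉ B i} ∈ U := by
    refine Filter.mem_of_superset (Ultrafilter.compl_mem_iff_notMem.2 hn) fun i hi => ?_
    exact Set.not_subset.1 hi
  obtain ⟨f, hf⟩ := exists_choice_of_eventually_exists U hn'
  have hfB : {i | f i ∈ B i} ∈ U :=
    h (show uMk U f ∈ thetaSet U A from Filter.mem_of_superset hf fun i hi => hi.1)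
  obtain ⟨i, hi, hi'⟩ := U.nonempty_of_mem (Filter.inter_mem hf hfB)
  exact hi.2 hi'

variable {X Y : Type*} (R : X → Y → Prop)

lemma thetaSet_lam (B : I → Set Y) :
    thetaSet U (fun i => lam R (B i)) = lam (uRel U fun _ => R) (thetaSet U B) := by
  ext m
  obtain ⟨f, rfl⟩ := uMk_surjective U _ m
  refine ⟨fun hf n hn => ?_, fun hf => ?_⟩
  · obtain ⟨g, rfl⟩ := uMk_surjective U _ n
    exact Filter.mem_of_superset (Filter.inter_mem hf hn) fun i hi => hi.1 _ hi.2
  · have := eventually_subset_of_thetaSet_subset U (A := B) (B := fun i => {y | R (f i) y})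
      fun n hn => by
        obtain ⟨g, rfl⟩ := uMk_surjective U _ n
        exact hf _ hn
    exact Filter.mem_of_superset this fun i hi y hy => hi hy

lemma thetaSet_rho (A : I → Set X) :
    thetaSet U (fun i => rho R (A i)) = rho (uRel U fun _ => R) (thetaSet U A) := by
  ext n
  obtain ⟨g, rfl⟩ := uMk_surjective U _ n
  refine ⟨fun hg m hm => ?_, fun hg => ?_⟩
  · obtain ⟨f, rfl⟩ := uMk_surjective U _ m
    exact Filter.mem_of_superset (Filter.inter_mem hg hm) fun i hi => hi.1 _ hi.2
  · have := eventually_subset_of_thetaSet_subset U (A := A) (B := fun i => {x | R x (g i)})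
      fun m hm => by
        obtain ⟨f, rfl⟩ := uMk_surjective U _ m
        exact hg _ hm
    exact Filter.mem_of_superset this fun i hi x hx => hi hx

lemma isStable_thetaSet (β : I → Stable R) :
    IsStable (uRel U fun _ => R) (thetaSet U fun i => (β i).1) := by
  have h := thetaSet_lam U R fun i => rho R (β i).1
  simp only [(β _).2.lam_rho_eq] at h
  rw [h]
  exact isStable_lam _ _

/-- The map `θ` from the ultrapower of the stable set lattice to the stable set lattice of the
ultrapower. -/
def theta (m : UProd U (fun _ : I => Stable R)) : Stable (uRel U (fun _ : I => R)) :=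
  Quotient.lift (s := uSetoid U fun _ : I => Stable R)
    (fun β => ⟨thetaSet U fun i => (β i).1, isStable_thetaSet U R β⟩)
    (fun _ _ h => Subtype.ext (thetaSet_congr U
      (Filter.mem_of_superset h fun _ hi => congrArg Subtype.val hi))) m

lemma val_theta (β : I → Stable R) :
    (theta U R (uMk U β)).1 = thetaSet U fun i => (β i).1 := rfl

lemma theta_injective : Function.Injective (theta U R) := by
  intro a b hab
  obtain ⟨α, rfl⟩ := uMk_surjective U _ a
  obtain ⟨β, rfl⟩ := uMk_surjective U _ b
  have h : (thetaSet U fun i => (α i).1) = thetaSet U fun i => (β i).1 := congrArg Subtype.val hab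
  refine Quotient.sound (s := uSetoid U fun _ : I => Stable R) ?_
  exact Filter.mem_of_superset (Filter.inter_mem (eventually_subset_of_thetaSet_subset U h.subset)
    (eventually_subset_of_thetaSet_subset U h.superset))
    fun i hi => Subtype.ext (Set.Subset.antisymm hi.1 hi.2)

lemma theta_ofLam (B : I → Set Y) :
    theta U R (uMk U fun i => Stable.ofLam R (B i)) = Stable.ofLam _ (thetaSet U B) :=
  Subtype.ext (thetaSet_lam U R B)

lemma joinDense_range_theta : JoinDense (Set.range (theta U R)) := by
  refine fun A => ⟨_, ?_, A.eq_sSup_principal⟩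
  rintro _ ⟨m, -, rfl⟩
  obtain ⟨f, rfl⟩ := uMk_surjective U _ m
  refine ⟨uMk U fun i => Stable.ofLam R (rho R {f i}), ?_⟩
  rw [theta_ofLam, thetaSet_rho, thetaSet_singleton]

lemma meetDense_range_theta : MeetDense (Set.range (theta U R)) := by
  refine fun A => ⟨_, ?_, A.eq_sInf_principal⟩
  rintro _ ⟨n, -, rfl⟩
  obtain ⟨g, rfl⟩ := uMk_surjective U _ n
  refine ⟨uMk U fun i => Stable.ofLam R {g i}, ?_⟩
  rw [theta_ofLam, thetaSet_singleton]

end Theta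
end PaperCore

open PaperCore in
/-- for a single polarity `P` and ultrafilter `U`, the map `θ` is a MacNeille
completion of the ultrapower `(P⁺)^U`: an injective bounded-lattice homomorphism into the
complete lattice `(P^U)⁺` with join-dense and meet-dense image. -/
theorem statement8 {I : Type*} (U : Ultrafilter I) {X Y : Type*} (R : X → Y → Prop) :
    ∃ θ : UProd U (fun _ : I => Stable R) → Stable (uRel U (fun _ : I => R)),
      (∀ β : I → Stable R, (θ (uMk U β)).1 = thetaSet U (fun i => (β i).1)) ∧
      Function.Injective θ ∧
      (∀ α β : I → Stable R,
        θ (uMk U (fun i => α i ⊓ β i)) = θ (uMk U α) ⊓ θ (uMk U β)) ∧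
      (∀ α β : I → Stable R,
        θ (uMk U (fun i => α i ⊔ β i)) = θ (uMk U α) ⊔ θ (uMk U β)) ∧
      θ (uMk U (fun _ => (⊤ : Stable R))) = ⊤ ∧
      θ (uMk U (fun _ => (⊥ : Stable R))) = ⊥ ∧
      JoinDense (Set.range θ) ∧ MeetDense (Set.range θ) := by
  refine ⟨theta U R, val_theta U R, theta_injective U R, fun α β => Subtype.ext ?_,
    fun α β => Subtype.ext ?_, Subtype.ext ?_, Subtype.ext ?_,
    joinDense_range_theta U R, meetDense_range_theta U R⟩
  · simp only [val_theta, Stable.val_inf, thetaSet_inter]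
  · simp only [val_theta, Stable.val_sup, thetaSet_lam, thetaSet_inter, thetaSet_rho]
  · simp only [val_theta, Stable.val_top, thetaSet_univ]
  · simp only [val_theta, Stable.val_bot, thetaSet_lam, thetaSet_univ]
end

section
/- If (θ₁, C₁) and (θ₂, C₂) are both dense and compact completions of a bounded lattice L, then there is a unique isomorphism of lattices h : C₁ → C₂ such that h ∘ θ₁ = θ₂. -/
open FirstOrder FirstOrder.Language FirstOrder.Language.Structure

namespace PaperCore

section Uniqueness

variable {L C C₁ C₂ : Type*} [CompleteLattice C] [CompleteLattice C₁] [CompleteLattice C₂]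

lemma ClosedElt.exists_eq_sInf_image {θ : L → C} {c : C} (hc : ClosedElt (Set.range θ) c) :
    ∃ F : Set L, c = sInf (θ '' F) := by
  obtain ⟨S, hS, rfl⟩ := hc
  obtain ⟨F, rfl⟩ := Set.subset_range_iff_exists_image_eq.1 hS
  exact ⟨F, rfl⟩

lemma OpenElt.exists_eq_sSup_image {θ : L → C} {c : C} (hc : OpenElt (Set.range θ) c) :
    ∃ I : Set L, c = sSup (θ '' I) := by
  obtain ⟨S, hS, rfl⟩ := hc
  obtain ⟨I, rfl⟩ := Set.subset_range_iff_exists_image_eq.1 hS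
  exact ⟨I, rfl⟩

/-- In a dense completion, `x ≤ y` can be tested on the closed elements below `x`. -/
lemma DenseCompletion.le_of_forall_closed_le {θ : L → C} (hd : DenseCompletion (Set.range θ))
    {x y : C} (h : ∀ F : Set L, sInf (θ '' F) ≤ x → sInf (θ '' F) ≤ y) : x ≤ y := by
  obtain ⟨G, hG, rfl⟩ := (hd x).1
  refine sSup_le fun c hc => ?_
  obtain ⟨F, rfl⟩ := (hG c hc).exists_eq_sInf_image
  exact h F (le_sSup hc)

/-- In a dense completion, `x ≤ y` can be tested on the open elements above `y`. -/
lemma DenseCompletion.le_of_forall_le_open {θ : L → C} (hd : DenseCompletion (Set.range θ))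
    {x y : C} (h : ∀ I : Set L, y ≤ sSup (θ '' I) → x ≤ sSup (θ '' I)) : x ≤ y := by
  obtain ⟨G, hG, rfl⟩ := (hd y).2
  refine le_sInf fun o ho => ?_
  obtain ⟨I, rfl⟩ := (hG o ho).exists_eq_sSup_image
  exact h I (sInf_le ho)

lemma DenseCompletion.eq_of_forall_le_open_iff {θ : L → C} (hd : DenseCompletion (Set.range θ))
    {x y : C} (h : ∀ I : Set L, x ≤ sSup (θ '' I) ↔ y ≤ sSup (θ '' I)) : x = y :=
  le_antisymm (hd.le_of_forall_le_open fun I => (h I).2)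
    (hd.le_of_forall_le_open fun I => (h I).1)

/-- In a compact completion, the order between closed and open elements is determined by `L`. -/
lemma CompactCompletion.sInf_image_le_sSup_image_iff [Lattice L] [BoundedOrder L]
    {θ : BoundedLatticeHom L C} (hθ : Function.Injective θ)
    (hc : CompactCompletion (Set.range ⇑θ)) {F I : Set L} :
    sInf (θ '' F) ≤ sSup (θ '' I) ↔
      ∃ F' I' : Finset L, ↑F' ⊆ F ∧ ↑I' ⊆ I ∧ F'.inf id ≤ I'.sup id := by
  classical
  constructor
  · intro h
    obtain ⟨S, T, hS, hT, hST⟩ := hc (θ '' F) (θ '' I)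
      (by rintro _ ⟨a, -, rfl⟩; exact ⟨{θ a}, by simp, by simp⟩)
      (by rintro _ ⟨a, -, rfl⟩; exact ⟨{θ a}, by simp, by simp⟩) h
    obtain ⟨F', hF', rfl⟩ := Finset.subset_set_image_iff.1 hS
    obtain ⟨I', hI', rfl⟩ := Finset.subset_set_image_iff.1 hT
    refine ⟨F', I', hF', hI', ?_⟩
    rw [← Finset.inf_id_eq_sInf, ← Finset.sup_id_eq_sSup, Finset.inf_image, Finset.sup_image,
      Function.id_comp, ← Function.comp_id θ, ← map_finset_inf, ← map_finset_sup,
      ← inf_eq_left, ← map_inf] at hST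
    exact inf_eq_left.1 (hθ hST)
  · rintro ⟨F', I', hF', hI', h⟩
    calc sInf (θ '' F) ≤ F'.inf (θ ∘ id) :=
          Finset.le_inf fun a ha => sInf_le ⟨a, hF' ha, rfl⟩
      _ = θ (F'.inf id) := (map_finset_inf θ _ _).symm
      _ ≤ θ (I'.sup id) := OrderHomClass.mono θ h
      _ = I'.sup (θ ∘ id) := map_finset_sup θ _ _
      _ ≤ sSup (θ '' I) := Finset.sup_le fun a ha => le_sSup ⟨a, hI' ha, rfl⟩

/-- The map between completions sending `x` to the join of the closed elements that correspond to
the closed elements below `x`. -/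
def transfer (θ₁ : L → C₁) (θ₂ : L → C₂) (x : C₁) : C₂ :=
  ⨆ (F : Set L) (_ : sInf (θ₁ '' F) ≤ x), sInf (θ₂ '' F)

lemma transfer_mono (θ₁ : L → C₁) (θ₂ : L → C₂) : Monotone (transfer θ₁ θ₂) :=
  fun _ _ hxy => iSup₂_le fun F hF => le_iSup₂_of_le F (hF.trans hxy) le_rfl

lemma transfer_le_open_iff {θ₁ : L → C₁} {θ₂ : L → C₂} (hd : DenseCompletion (Set.range θ₁))
    (h : ∀ F I : Set L, sInf (θ₁ '' F) ≤ sSup (θ₁ '' I) ↔ sInf (θ₂ '' F) ≤ sSup (θ₂ '' I))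
    {x : C₁} {I : Set L} :
    transfer θ₁ θ₂ x ≤ sSup (θ₂ '' I) ↔ x ≤ sSup (θ₁ '' I) := by
  simp only [transfer, iSup₂_le_iff, ← h]
  exact ⟨hd.le_of_forall_closed_le, fun hx F hF => hF.trans hx⟩

lemma transfer_transfer {θ₁ : L → C₁} {θ₂ : L → C₂} (hd₁ : DenseCompletion (Set.range θ₁))
    (hd₂ : DenseCompletion (Set.range θ₂))
    (h : ∀ F I : Set L, sInf (θ₁ '' F) ≤ sSup (θ₁ '' I) ↔ sInf (θ₂ '' F) ≤ sSup (θ₂ '' I))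
    (x : C₁) : transfer θ₂ θ₁ (transfer θ₁ θ₂ x) = x :=
  hd₁.eq_of_forall_le_open_iff fun _ => by
    rw [transfer_le_open_iff hd₂ fun F I => (h F I).symm, transfer_le_open_iff hd₁ h]

/-- The order isomorphism between two dense completions whose closed and open elements are related
in the same way. -/
def transferIso {θ₁ : L → C₁} {θ₂ : L → C₂} (hd₁ : DenseCompletion (Set.range θ₁))
    (hd₂ : DenseCompletion (Set.range θ₂))
    (h : ∀ F I : Set L, sInf (θ₁ '' F) ≤ sSup (θ₁ '' I) ↔ sInf (θ₂ '' F) ≤ sSup (θ₂ '' I)) :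
    C₁ ≃o C₂ :=
  Equiv.toOrderIso
    { toFun := transfer θ₁ θ₂
      invFun := transfer θ₂ θ₁
      left_inv := transfer_transfer hd₁ hd₂ h
      right_inv := transfer_transfer hd₂ hd₁ fun F I => (h F I).symm }
    (transfer_mono θ₁ θ₂) (transfer_mono θ₂ θ₁)

lemma transferIso_apply_embedding {θ₁ : L → C₁} {θ₂ : L → C₂}
    (hd₁ : DenseCompletion (Set.range θ₁)) (hd₂ : DenseCompletion (Set.range θ₂))
    (h : ∀ F I : Set L, sInf (θ₁ '' F) ≤ sSup (θ₁ '' I) ↔ sInf (θ₂ '' F) ≤ sSup (θ₂ '' I))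
    (a : L) : transferIso hd₁ hd₂ h (θ₁ a) = θ₂ a :=
  hd₂.eq_of_forall_le_open_iff fun I =>
    (transfer_le_open_iff hd₁ h).trans (by simpa using h {a} I)

/-- An order isomorphism out of a dense completion is determined by its values on the image of the
embedding. -/
lemma DenseCompletion.orderIso_ext {θ : L → C₁} (hd : DenseCompletion (Set.range θ))
    {f g : C₁ ≃o C₂} (h : ∀ a, f (θ a) = g (θ a)) : f = g := by
  have hclosed (F : Set L) : f (sInf (θ '' F)) = g (sInf (θ '' F)) := by
    simp only [sInf_image, map_iInf, h]
  ext x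
  obtain ⟨G, hG, rfl⟩ := (hd x).1
  rw [f.map_sSup, g.map_sSup]
  refine biSup_congr fun c hc => ?_
  obtain ⟨F, rfl⟩ := (hG c hc).exists_eq_sInf_image
  exact hclosed F

end Uniqueness

end PaperCore

open PaperCore in
/-- uniqueness of dense and compact completions (canonical extensions):
any two are related by a unique lattice isomorphism commuting with the embeddings. -/
theorem statement10 {L C₁ C₂ : Type*} [Lattice L] [BoundedOrder L]
    [CompleteLattice C₁] [CompleteLattice C₂]
    (θ₁ : BoundedLatticeHom L C₁) (θ₂ : BoundedLatticeHom L C₂)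
    (h₁ : Function.Injective θ₁) (h₂ : Function.Injective θ₂)
    (hd₁ : DenseCompletion (Set.range ⇑θ₁)) (hc₁ : CompactCompletion (Set.range ⇑θ₁))
    (hd₂ : DenseCompletion (Set.range ⇑θ₂)) (hc₂ : CompactCompletion (Set.range ⇑θ₂)) :
    ∃! h : C₁ ≃o C₂, ∀ a : L, h (θ₁ a) = θ₂ a := by
  have h (F I : Set L) :
      sInf (θ₁ '' F) ≤ sSup (θ₁ '' I) ↔ sInf (θ₂ '' F) ≤ sSup (θ₂ '' I) :=
    (hc₁.sInf_image_le_sSup_image_iff h₁).trans (hc₂.sInf_image_le_sSup_image_iff h₂).symm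
  have hext := transferIso_apply_embedding hd₁ hd₂ h
  exact ⟨transferIso hd₁ hd₂ h, hext,
    fun g hg => hd₁.orderIso_ext fun a => (hg a).trans (hext a).symm⟩
end

section
/- Let {L_i : i ∈ I} be a family of bounded lattices and let βI be the set of all ultrafilters on I. Suppose (η, C) is a dense and compact completion of the direct product ∏_I L_i, and for each U ∈ βI, (η_U, C_U) is a dense and compact completion of the ultraproduct ∏_U L_i. Then there is an isomorphism of lattices between C and the direct product ∏_{U ∈ βI} C_U. -/
open FirstOrder FirstOrder.Language FirstOrder.Language.Structure

namespace PaperCore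

section Determination
variable {X Y C D : Type*} [CompleteLattice C] [CompleteLattice D]

/-- A complete lattice is determined by the order relation between a join-dense and a meet-dense
family of its elements. -/
theorem nonempty_orderIso_of_dense_families {c : X → C} {o : Y → C} {c' : X → D} {o' : Y → D}
    (hc : ∀ z w, (∀ x, c x ≤ z → c x ≤ w) → z ≤ w)
    (ho : ∀ z w, (∀ y, w ≤ o y → z ≤ o y) → z ≤ w)
    (hc' : ∀ z w, (∀ x, c' x ≤ z → c' x ≤ w) → z ≤ w)
    (ho' : ∀ z w, (∀ y, w ≤ o' y → z ≤ o' y) → z ≤ w)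
    (hco : ∀ x y, c x ≤ o y ↔ c' x ≤ o' y) : Nonempty (C ≃o D) := by
  let f : C → D := fun z => ⨆ (x) (_ : c x ≤ z), c' x
  let g : D → C := fun z => ⨆ (x) (_ : c' x ≤ z), c x
  have hf : ∀ z y, f z ≤ o' y ↔ z ≤ o y := fun z y => by
    refine ⟨fun h => hc _ _ fun x hx => ?_, fun h => iSup₂_le fun x hx => ?_⟩
    · exact (hco x y).2 ((le_iSup₂ (f := fun x (_ : c x ≤ z) => c' x) x hx).trans h)
    · exact (hco x y).1 (hx.trans h)
  have hg : ∀ z y, g z ≤ o y ↔ z ≤ o' y := fun z y => by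
    refine ⟨fun h => hc' _ _ fun x hx => ?_, fun h => iSup₂_le fun x hx => ?_⟩
    · exact (hco x y).1 ((le_iSup₂ (f := fun x (_ : c' x ≤ z) => c x) x hx).trans h)
    · exact (hco x y).2 (hx.trans h)
  refine ⟨⟨⟨f, g, fun z => ?_, fun z => ?_⟩, fun {z w} => ?_⟩⟩
  · exact le_antisymm (ho _ _ fun y => by rw [hg, hf]; exact id)
      (ho _ _ fun y => by rw [hg, hf]; exact id)
  · exact le_antisymm (ho' _ _ fun y => by rw [hf, hg]; exact id)
      (ho' _ _ fun y => by rw [hf, hg]; exact id)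
  · refine ⟨fun h => ho _ _ fun y hy => ?_, fun h => ho' _ _ fun y hy => ?_⟩
    · exact (hf z y).1 (h.trans ((hf w y).2 hy))
    · exact (hf z y).2 (h.trans ((hf w y).1 hy))

end Determination

section Completion
variable {M C : Type*} [CompleteLattice C] {e : M → C}

lemma DenseCompletion.le_of_closed (h : DenseCompletion (Set.range e)) {z w : C}
    (H : ∀ S : Set M, sInf (e '' S) ≤ z → sInf (e '' S) ≤ w) : z ≤ w := by
  obtain ⟨⟨G, hG, rfl⟩, -⟩ := h z
  refine sSup_le fun k hk => ?_
  obtain ⟨S, hS, rfl⟩ := hG k hk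
  obtain ⟨S, rfl⟩ := Set.subset_range_iff_exists_image_eq.1 hS
  exact H S (le_sSup hk)

lemma DenseCompletion.le_of_open (h : DenseCompletion (Set.range e)) {z w : C}
    (H : ∀ T : Set M, w ≤ sSup (e '' T) → z ≤ sSup (e '' T)) : z ≤ w := by
  obtain ⟨-, ⟨G, hG, rfl⟩⟩ := h w
  refine le_sInf fun k hk => ?_
  obtain ⟨T, hT, rfl⟩ := hG k hk
  obtain ⟨T, rfl⟩ := Set.subset_range_iff_exists_image_eq.1 hT
  exact H T (sInf_le hk)

lemma CompactCompletion.exists_finset [Lattice M] [BoundedOrder M] (e : BoundedLatticeHom M C)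
    (h : CompactCompletion (Set.range e)) {S T : Set M} (hST : sInf (e '' S) ≤ sSup (e '' T)) :
    ∃ S' T' : Finset M, ↑S' ⊆ S ∧ ↑T' ⊆ T ∧ e (S'.inf id) ≤ e (T'.sup id) := by
  classical
  obtain ⟨S₁, T₁, hS₁, hT₁, hle⟩ := h _ _
    (fun c hc => ⟨{c}, Set.singleton_subset_iff.2 (Set.image_subset_range _ _ hc),
      sInf_singleton.symm⟩)
    (fun c hc => ⟨{c}, Set.singleton_subset_iff.2 (Set.image_subset_range _ _ hc),
      sSup_singleton.symm⟩) hST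
  obtain ⟨S', hS, rfl⟩ := Finset.subset_set_image_iff.1 hS₁
  obtain ⟨T', hT, rfl⟩ := Finset.subset_set_image_iff.1 hT₁
  refine ⟨S', T', hS, hT, ?_⟩
  rw [map_finset_inf, map_finset_sup]
  simpa [Finset.inf_eq_iInf, Finset.sup_eq_iSup, sInf_image, sSup_image] using hle

lemma sInf_image_le_sSup_image [Lattice M] [BoundedOrder M] (e : BoundedLatticeHom M C)
    {S T : Set M} {S' T' : Finset M} (hS : ↑S' ⊆ S) (hT : ↑T' ⊆ T)
    (h : S'.inf id ≤ T'.sup id) : sInf (e '' S) ≤ sSup (e '' T) := by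
  have h' := OrderHomClass.mono e h
  rw [map_finset_inf, map_finset_sup] at h'
  refine le_trans (Finset.le_inf fun s hs => ?_) (h'.trans (Finset.sup_le fun t ht => ?_))
  · exact sInf_le (Set.mem_image_of_mem e (hS hs))
  · exact le_sSup (Set.mem_image_of_mem e (hT ht))

end Completion

lemma exists_finset_forall_exists_mem {I : Type*} (A : Ultrafilter I → Set I)
    (hA : ∀ U, A U ∈ U) : ∃ t : Finset (Ultrafilter I), ∀ i, ∃ U ∈ t, i ∈ A U := by
  obtain ⟨t, ht⟩ := isCompact_univ.elim_finite_subcover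
    (fun U => {V : Ultrafilter I | A U ∈ V}) (fun U => ultrafilter_isOpen_basic (A U))
    (fun U _ => Set.mem_iUnion.2 ⟨U, hA U⟩)
  refine ⟨t, fun i => ?_⟩
  obtain ⟨U, hU, hi⟩ := Set.mem_iUnion₂.1 (ht (Set.mem_univ (pure i)))
  exact ⟨U, hU, hi⟩

lemma uMk_eq_uMk {I : Type*} {U : Ultrafilter I} {β : I → Type*} {f g : ∀ i, β i} :
    uMk U f = uMk U g ↔ {i | f i = g i} ∈ U :=
  Quotient.eq

section UltraproductFamily
variable {I : Type*} {L : I → Type*} [∀ i, Lattice (L i)] [∀ i, BoundedOrder (L i)]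

open Classical in
/-- The element of the product that is `⊤` on `A` and `⊥` off `A`. -/
noncomputable def topOn (L : I → Type*) [∀ i, Lattice (L i)] [∀ i, BoundedOrder (L i)]
    (A : Set I) (i : I) : L i :=
  if i ∈ A then ⊤ else ⊥

lemma uMk_topOn_of_mem {U : Ultrafilter I} {A : Set I} (h : A ∈ U) :
    uMk U (topOn L A) = uMk U (⊤ : ∀ i, L i) :=
  uMk_eq_uMk.2 (Filter.mem_of_superset h fun _ hi => if_pos hi)

lemma uMk_topOn_of_compl_mem {U : Ultrafilter I} {A : Set I} (h : Aᶜ ∈ U) :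
    uMk U (topOn L A) = uMk U (⊥ : ∀ i, L i) :=
  uMk_eq_uMk.2 (Filter.mem_of_superset h fun _ hi => if_neg hi)

lemma exists_mem_compl_mem {U V : Ultrafilter I} (h : V ≠ U) : ∃ A ∈ U, Aᶜ ∈ V := by
  by_contra! H
  refine h (Ultrafilter.coe_le_coe.1 fun A hA => ?_)
  by_contra hn
  exact H A hA (Ultrafilter.compl_mem_iff_notMem.2 hn)

variable {K : Ultrafilter I → Type*} [∀ U, CompleteLattice (K U)]
  (g : ∀ U, BoundedLatticeHom (∀ i, L i) (K U))

lemma exists_sInf_image_eq_update [DecidableEq (Ultrafilter I)]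
    (hg : ∀ U a b, uMk U a = uMk U b → g U a = g U b)
    (U : Ultrafilter I) (S : Set (∀ i, L i)) :
    ∃ S' : Set (∀ i, L i), (fun V => sInf (g V '' S')) =
      Function.update (⊥ : ∀ V, K V) U (sInf (g U '' S)) := by
  refine ⟨S ∪ topOn L '' {A | A ∈ U}, funext fun V => ?_⟩
  rcases eq_or_ne V U with rfl | hV
  · rw [Function.update_self, Set.image_union, sInf_union, inf_eq_left]
    refine le_sInf ?_
    rintro _ ⟨_, ⟨A, hA, rfl⟩, rfl⟩
    rw [hg _ _ _ (uMk_topOn_of_mem hA), map_top]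
    exact le_top
  · rw [Function.update_of_ne hV]
    obtain ⟨A, hA, hAV⟩ := exists_mem_compl_mem hV
    refine le_bot_iff.1 (sInf_le ⟨topOn L A, Or.inr ⟨A, hA, rfl⟩, ?_⟩)
    rw [hg _ _ _ (uMk_topOn_of_compl_mem hAV), map_bot]

lemma exists_sSup_image_eq_update [DecidableEq (Ultrafilter I)]
    (hg : ∀ U a b, uMk U a = uMk U b → g U a = g U b)
    (U : Ultrafilter I) (T : Set (∀ i, L i)) :
    ∃ T' : Set (∀ i, L i), (fun V => sSup (g V '' T')) =
      Function.update (⊤ : ∀ V, K V) U (sSup (g U '' T)) := by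
  refine ⟨T ∪ topOn L '' {A | Aᶜ ∈ U}, funext fun V => ?_⟩
  rcases eq_or_ne V U with rfl | hV
  · rw [Function.update_self, Set.image_union, sSup_union, sup_eq_left]
    refine sSup_le ?_
    rintro _ ⟨_, ⟨A, hA, rfl⟩, rfl⟩
    rw [hg _ _ _ (uMk_topOn_of_compl_mem hA), map_bot]
    exact bot_le
  · rw [Function.update_of_ne hV]
    obtain ⟨A, hA, hAU⟩ := exists_mem_compl_mem hV.symm
    refine top_le_iff.1 (le_sSup ⟨topOn L A, Or.inr ⟨A, hAU, rfl⟩, ?_⟩)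
    rw [hg _ _ _ (uMk_topOn_of_mem hA), map_top]

/-- The order relation between closed and open elements of a product of compact completions of
all ultraproducts. -/
lemma sInf_image_le_sSup_image_iff
    (hg : ∀ U a b, g U a ≤ g U b ↔ {i | a i ≤ b i} ∈ U)
    (hcompact : ∀ U, CompactCompletion (Set.range (g U))) {S T : Set (∀ i, L i)} :
    (∀ U, sInf (g U '' S) ≤ sSup (g U '' T)) ↔
      ∃ S' T' : Finset (∀ i, L i), ↑S' ⊆ S ∧ ↑T' ⊆ T ∧ S'.inf id ≤ T'.sup id := by
  classical
  refine ⟨fun h => ?_, fun ⟨S', T', hS, hT, h⟩ U => sInf_image_le_sSup_image (g U) hS hT h⟩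
  choose F G hF hG hFG using fun U => (hcompact U).exists_finset (g U) (h U)
  obtain ⟨t, ht⟩ := exists_finset_forall_exists_mem _ fun U => (hg U _ _).1 (hFG U)
  refine ⟨t.biUnion F, t.biUnion G, by simpa using fun U _ => hF U,
    by simpa using fun U _ => hG U, fun i => ?_⟩
  obtain ⟨U, hU, hi⟩ := ht i
  have hinf : (t.biUnion F).inf id ≤ (F U).inf id :=
    Finset.inf_mono (Finset.subset_biUnion_of_mem F hU)
  have hsup : (G U).sup id ≤ (t.biUnion G).sup id :=
    Finset.sup_mono (Finset.subset_biUnion_of_mem G hU)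
  exact (hinf i).trans (le_trans hi (hsup i))

end UltraproductFamily

end PaperCore

open PaperCore in
/-- a dense and compact completion of a direct product `∏_I L_i` of bounded
lattices is isomorphic to the direct product, over all ultrafilters `U` on `I`, of dense and
compact completions of the ultraproducts `∏_U L_i`. -/
theorem statement11 {I : Type} {L : I → Type} [∀ i, Lattice (L i)] [∀ i, BoundedOrder (L i)]
    {C : Type*} [CompleteLattice C] (η : BoundedLatticeHom (∀ i, L i) C)
    (hηinj : Function.Injective η)
    (hηdense : DenseCompletion (Set.range ⇑η)) (hηcompact : CompactCompletion (Set.range ⇑η))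
    (CU : Ultrafilter I → Type*) [∀ U, CompleteLattice (CU U)]
    (ηU : ∀ U : Ultrafilter I, UProd U L → CU U)
    (hUinj : ∀ U, Function.Injective (ηU U))
    (hUinf : ∀ (U) (a b : ∀ i, L i),
      ηU U (uMk U (fun i => a i ⊓ b i)) = ηU U (uMk U a) ⊓ ηU U (uMk U b))
    (hUsup : ∀ (U) (a b : ∀ i, L i),
      ηU U (uMk U (fun i => a i ⊔ b i)) = ηU U (uMk U a) ⊔ ηU U (uMk U b))
    (hUtop : ∀ U, ηU U (uMk U (fun i => (⊤ : L i))) = ⊤)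
    (hUbot : ∀ U, ηU U (uMk U (fun i => (⊥ : L i))) = ⊥)
    (hUdense : ∀ U, DenseCompletion (Set.range (ηU U)))
    (hUcompact : ∀ U, CompactCompletion (Set.range (ηU U))) :
    Nonempty (C ≃o (∀ U : Ultrafilter I, CU U)) := by
  classical
  let g : ∀ U, BoundedLatticeHom (∀ i, L i) (CU U) := fun U =>
    { toFun := fun a => ηU U (uMk U a)
      map_sup' := hUsup U
      map_inf' := hUinf U
      map_top' := hUtop U
      map_bot' := hUbot U }
  have hgeq : ∀ U a b, uMk U a = uMk U b → g U a = g U b := fun U a b h => congrArg (ηU U) h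
  have hgle : ∀ U a b, g U a ≤ g U b ↔ {i | a i ≤ b i} ∈ U := fun U a b => by
    rw [← inf_eq_left, ← map_inf, show g U (a ⊓ b) = g U a ↔ uMk U (a ⊓ b) = uMk U a from
      (hUinj U).eq_iff, uMk_eq_uMk]
    simp
  have hrange : ∀ U, Set.range (g U) = Set.range (ηU U) :=
    fun U => (uMk_surjective U L).range_comp (ηU U)
  have hgdense : ∀ U, DenseCompletion (Set.range (g U)) := fun U => hrange U ▸ hUdense U
  have hgcompact : ∀ U, CompactCompletion (Set.range (g U)) := fun U => hrange U ▸ hUcompact U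
  refine nonempty_orderIso_of_dense_families
    (c := fun S : Set (∀ i, L i) => sInf (η '' S)) (o := fun T : Set (∀ i, L i) => sSup (η '' T))
    (c' := fun S U => sInf (g U '' S)) (o' := fun T U => sSup (g U '' T))
    (fun _ _ => hηdense.le_of_closed) (fun _ _ => hηdense.le_of_open) ?_ ?_ ?_
  · refine fun z w H U => (hgdense U).le_of_closed fun S hS => ?_
    obtain ⟨S', hS'⟩ := exists_sInf_image_eq_update g hgeq U S
    have := H S'
    rw [hS', update_le_iff, update_le_iff] at this
    exact (this ⟨hS, fun _ _ => bot_le⟩).1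
  · refine fun z w H U => (hgdense U).le_of_open fun T hT => ?_
    obtain ⟨T', hT'⟩ := exists_sSup_image_eq_update g hgeq U T
    have := H T'
    rw [hT', le_update_iff, le_update_iff] at this
    exact (this ⟨hT, fun _ _ => le_top⟩).1
  · refine fun S T => Iff.trans ⟨fun h => ?_, ?_⟩
      (sInf_image_le_sSup_image_iff g hgle hgcompact).symm
    · obtain ⟨S', T', hS, hT, hle⟩ := hηcompact.exists_finset η h
      refine ⟨S', T', hS, hT, inf_eq_left.1 (hηinj ?_)⟩
      rw [map_inf, inf_eq_left.2 hle]
    · rintro ⟨S', T', hS, hT, hle⟩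
      exact sInf_image_le_sSup_image η hS hT hle
end

section
/- Let P = (X, Y, R, T) be a Lambek frame. Then for all stable A, B, C ⊆ X: B ⊆ A\C if and only if A ⊗ B ⊆ C, if and only if A ⊆ C/B. That is, \ and / are the left and right residuals of the fusion ⊗ on the stable set lattice P⁺. -/
open FirstOrder FirstOrder.Language FirstOrder.Language.Structure

namespace PaperCore
section Lambek
variable {X Y : Type*}

/-- `P` is separating. -/
def Separating (R : X → Y → Prop) : Prop :=
  (∀ x x' : X, rho R {x} = rho R {x'} → x = x') ∧
  (∀ y y' : Y, lam R {y} = lam R {y'} → y = y')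

/-- `P` is reduced. -/
def Reduced (R : X → Y → Prop) : Prop :=
  (∀ x : X, ∃ y : Y, ¬ R x y ∧ ∀ x' : X, rho R {x} ⊂ rho R {x'} → R x' y) ∧
  (∀ y : Y, ∃ x : X, ¬ R x y ∧ ∀ y' : Y, lam R {y'} ⊂ lam R {y} → R x y')

/-- A Lambek frame: separating, reduced, and all sections of `T` are stable. -/
def IsLambekFrame (R : X → Y → Prop) (T : X → X → Y → Prop) : Prop :=
  Separating R ∧ Reduced R ∧
  (∀ x₀ x₁ : X, IsStableY R {y' | T x₀ x₁ y'}) ∧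
  (∀ (x₀ : X) (y : Y), IsStable R {x | T x₀ x y}) ∧
  (∀ (x₁ : X) (y : Y), IsStable R {x | T x x₁ y})

/-- Fusion: `A₀ ⊗ A₁`. -/
def fusion (R : X → Y → Prop) (T : X → X → Y → Prop) (A₀ A₁ : Set X) : Set X :=
  ⋂₀ {S | ∃ y : Y, (∀ x₀ ∈ A₀, ∀ x₁ ∈ A₁, T x₀ x₁ y) ∧ S = lam R {y}}

/-- Left residual `A₀ \ A₁`. -/
def lres (R : X → Y → Prop) (T : X → X → Y → Prop) (A₀ A₁ : Set X) : Set X :=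
  {x | ∀ x₀ ∈ A₀, ∀ y ∈ rho R A₁, T x₀ x y}

/-- Right residual `A₀ / A₁`. -/
def rres (R : X → Y → Prop) (T : X → X → Y → Prop) (A₀ A₁ : Set X) : Set X :=
  {x | ∀ x₁ ∈ A₁, ∀ y ∈ rho R A₀, T x x₁ y}

end Lambek
end PaperCore

namespace PaperCore
section Residuation
variable {X Y : Type*} {R : X → Y → Prop} {T : X → X → Y → Prop}

lemma fusion_eq_lam (A B : Set X) :
    fusion R T A B = lam R {y | ∀ a ∈ A, ∀ b ∈ B, T a b y} := by
  ext x
  constructor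
  · intro hx y hy
    exact hx (lam R {y}) ⟨y, hy, rfl⟩ y rfl
  · rintro hx _ ⟨y, hy, rfl⟩ _ rfl
    exact hx _ hy

lemma isStableY_setOf_forall_mem (hT : ∀ x₀ x₁ : X, IsStableY R {y | T x₀ x₁ y})
    (A B : Set X) : IsStableY R {y | ∀ a ∈ A, ∀ b ∈ B, T a b y} :=
  fun _ hy a ha b hb =>
    have hsub : {y | ∀ a ∈ A, ∀ b ∈ B, T a b y} ⊆ {y | T a b y} := fun _ hz => hz a ha b hb
    hT a b (rho_anti (lam_anti hsub) hy)

lemma fusion_subset_iff (hT : ∀ x₀ x₁ : X, IsStableY R {y | T x₀ x₁ y})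
    {A B C : Set X} (hC : IsStable R C) :
    fusion R T A B ⊆ C ↔ ∀ a ∈ A, ∀ b ∈ B, ∀ y ∈ rho R C, T a b y := by
  rw [fusion_eq_lam]
  constructor
  · intro h a ha b hb y hy
    exact isStableY_setOf_forall_mem hT A B (rho_anti h hy) a ha b hb
  · intro h x hx
    exact hC fun y hy => hx y fun a ha b hb => h a ha b hb y hy

end Residuation
end PaperCore

open PaperCore in
/-- in a Lambek frame, `\` and `/` are the left and right residuals of the
fusion `⊗` on the stable set lattice. -/
theorem statement13 {X Y : Type*} {R : X → Y → Prop} {T : X → X → Y → Prop}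
    (h : IsLambekFrame R T) (A B C : Set X)
    (hA : IsStable R A) (hB : IsStable R B) (hC : IsStable R C) :
    (B ⊆ lres R T A C ↔ fusion R T A B ⊆ C) ∧
    (fusion R T A B ⊆ C ↔ A ⊆ rres R T C B) := by
  rw [fusion_subset_iff h.2.2.1 hC]
  exact ⟨⟨fun H a ha b hb => H hb a ha, fun H b hb a ha => H a ha b hb⟩, Iff.rfl⟩
end

section
/- Let P = (X, Y, R, T) be a Lambek frame. Then the fusion ⊗ is a complete normal operator on the stable set lattice P⁺: for every stable A ⊆ X and every set G of stable subsets of X, A ⊗ ⋁G = ⋁{A ⊗ B : B ∈ G} and (⋁G) ⊗ A = ⋁{B ⊗ A : B ∈ G}, where ⋁G = λρ(⋃G) is the join of G in P⁺ (the case G = ∅ giving A ⊗ 0 = 0 = 0 ⊗ A with 0 = λY). -/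
open FirstOrder FirstOrder.Language FirstOrder.Language.Structure

namespace PaperCore
section Fusion
variable {X Y : Type*} {R : X → Y → Prop} {T : X → X → Y → Prop}

lemma subset_lam_rho (A : Set X) : A ⊆ lam R (rho R A) := fun _ hx _ hy => hy _ hx

/-- The elements `y` with `T x₀ x₁ y` for all `x₀ ∈ A₀` and `x₁ ∈ A₁`. -/
def fusionBound (T : X → X → Y → Prop) (A₀ A₁ : Set X) : Set Y :=
  {y | ∀ x₀ ∈ A₀, ∀ x₁ ∈ A₁, T x₀ x₁ y}

lemma fusion_eq_lam_fusionBound (A₀ A₁ : Set X) :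
    fusion R T A₀ A₁ = lam R (fusionBound T A₀ A₁) := by
  ext x
  constructor
  · intro hx y hy
    exact hx _ ⟨y, hy, rfl⟩ y rfl
  · rintro hx _ ⟨y, hy, rfl⟩ _ rfl
    exact hx _ hy

lemma rho_fusion (h : ∀ x₀ x₁, IsStableY R {y | T x₀ x₁ y}) (A₀ A₁ : Set X) :
    rho R (fusion R T A₀ A₁) = fusionBound T A₀ A₁ := by
  rw [fusion_eq_lam_fusionBound]
  refine Set.Subset.antisymm (fun y hy x₀ h₀ x₁ h₁ => ?_) fun y hy x hx => hx y hy
  exact h x₀ x₁ (rho_anti (lam_anti fun z (hz : z ∈ fusionBound T A₀ A₁) => hz x₀ h₀ x₁ h₁) hy)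

lemma rho_biUnion {ι : Type*} (G : Set ι) (F : ι → Set X) :
    rho R (⋃ i ∈ G, F i) = ⋂ i ∈ G, rho R (F i) := by
  ext y
  simp only [rho, Set.mem_ofPred_eq, Set.mem_iUnion, Set.mem_iInter]
  exact ⟨fun hy i hi x hx => hy x ⟨i, hi, hx⟩, fun hy x ⟨i, hi, hx⟩ => hy i hi x hx⟩

lemma fusionBound_lam_rho_right (h : ∀ x₀ y, IsStable R {x | T x₀ x y}) (A U : Set X) :
    fusionBound T A (lam R (rho R U)) = fusionBound T A U :=
  Set.Subset.antisymm (fun _ hy x₀ h₀ x₁ h₁ => hy x₀ h₀ x₁ (subset_lam_rho U h₁))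
    fun y hy x₀ h₀ _ h₁ => h x₀ y (lamrho_mono (fun x₁ hx₁ => hy x₀ h₀ x₁ hx₁) h₁)

lemma fusionBound_lam_rho_left (h : ∀ x₁ y, IsStable R {x | T x x₁ y}) (U A : Set X) :
    fusionBound T (lam R (rho R U)) A = fusionBound T U A :=
  Set.Subset.antisymm (fun _ hy x₀ h₀ x₁ h₁ => hy x₀ (subset_lam_rho U h₀) x₁ h₁)
    fun y hy _ h₀ x₁ h₁ => h x₁ y (lamrho_mono (fun x₀ hx₀ => hy x₀ hx₀ x₁ h₁) h₀)

lemma fusionBound_sUnion_right (A : Set X) (G : Set (Set X)) :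
    fusionBound T A (⋃₀ G) = ⋂ B ∈ G, fusionBound T A B := by
  ext y
  simp only [fusionBound, Set.mem_ofPred_eq, Set.mem_iInter]
  exact ⟨fun hy B hB x₀ h₀ x₁ h₁ => hy x₀ h₀ x₁ ⟨B, hB, h₁⟩,
    fun hy x₀ h₀ x₁ ⟨B, hB, h₁⟩ => hy B hB x₀ h₀ x₁ h₁⟩

lemma fusionBound_sUnion_left (G : Set (Set X)) (A : Set X) :
    fusionBound T (⋃₀ G) A = ⋂ B ∈ G, fusionBound T B A := by
  ext y
  simp only [fusionBound, Set.mem_ofPred_eq, Set.mem_iInter]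
  exact ⟨fun hy B hB x₀ h₀ x₁ h₁ => hy x₀ ⟨B, hB, h₀⟩ x₁ h₁,
    fun hy x₀ ⟨B, hB, h₀⟩ x₁ h₁ => hy B hB x₀ h₀ x₁ h₁⟩

end Fusion
end PaperCore

open PaperCore in
/-- in a Lambek frame, fusion is a complete normal operator on the stable
set lattice: it distributes over arbitrary joins `⋁G = λρ(⋃G)` in each argument. -/
theorem statement14 {X Y : Type*} {R : X → Y → Prop} {T : X → X → Y → Prop}
    (h : IsLambekFrame R T) (A : Set X) (hA : IsStable R A)
    (G : Set (Set X)) (hG : ∀ B ∈ G, IsStable R B) :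
    fusion R T A (lam R (rho R (⋃₀ G))) = lam R (rho R (⋃ B ∈ G, fusion R T A B)) ∧
    fusion R T (lam R (rho R (⋃₀ G))) A = lam R (rho R (⋃ B ∈ G, fusion R T B A)) := by
  obtain ⟨-, -, hY, hr, hl⟩ := h
  constructor
  · simp only [rho_biUnion, rho_fusion hY]
    rw [fusion_eq_lam_fusionBound, fusionBound_lam_rho_right hr, fusionBound_sUnion_right]
  · simp only [rho_biUnion, rho_fusion hY]
    rw [fusion_eq_lam_fusionBound, fusionBound_lam_rho_left hl, fusionBound_sUnion_left]
end

section
/- Let P = (X, Y, R) be a polarity and T ⊆ X × Y a relation such that for every x ∈ X the section T[x, −] = {y ∈ Y : x T y} is a stable subset of Y and for every y ∈ Y the section T[−, y] = {x ∈ X : x T y} is a stable subset of X. Then for every A ⊆ X: □A = ⋂{T[−, y] : y ∈ ρA} and ◇A = ⋂{λ{y} : y ∈ Y and A ⊆ T[−, y]}, and both □A and ◇A are stable subsets of X. -/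
open FirstOrder FirstOrder.Language FirstOrder.Language.Structure

namespace PaperCore
section Modal
variable {X Y : Type*}

/-- `□A = {x ∈ X : ρA ⊆ T[x,−]}`. -/
def box (R T : X → Y → Prop) (A : Set X) : Set X := {x | rho R A ⊆ {y | T x y}}

/-- `◇A = λ{y ∈ Y : A ⊆ T[−,y]}`. -/
def dia (R T : X → Y → Prop) (A : Set X) : Set X := lam R {y | A ⊆ {x | T x y}}

end Modal
end PaperCore

open PaperCore in
/-- if all sections of `T` are stable then `□A` and `◇A` are intersections
of stable sets and are themselves stable subsets of `X`. -/
theorem statement15 {X Y : Type*} (R T : X → Y → Prop)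
    (hT1 : ∀ x : X, IsStableY R {y | T x y}) (hT2 : ∀ y : Y, IsStable R {x | T x y})
    (A : Set X) :
    box R T A = ⋂₀ {S | ∃ y ∈ rho R A, S = {x | T x y}} ∧
    dia R T A = ⋂₀ {S | ∃ y : Y, A ⊆ {x | T x y} ∧ S = lam R {y}} ∧
    IsStable R (box R T A) ∧ IsStable R (dia R T A) := by
  refine ⟨?_, ?_, ?_, ?_⟩
  · ext x
    constructor
    · rintro hx _ ⟨y, hy, rfl⟩
      exact hx hy
    · exact fun hx y hy => hx _ ⟨y, hy, rfl⟩
  · ext x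
    constructor
    · rintro hx _ ⟨y, hy, rfl⟩ _ rfl
      exact hx _ hy
    · exact fun hx y hy => hx _ ⟨y, hy, rfl⟩ y rfl
  · exact fun x hx y hy => hT2 y (lamrho_mono (fun _ (hz : _ ∈ box R T A) => hz hy) hx)
  · exact fun x hx y hy => hx y fun _ hz => hz y hy
end
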